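/- arXiv:2504.06711 — 3 statements merged into one kernel-verified Lean document; each statement's English description precedes it below -/
import Mathlib

section
/- Let n ≥ 2 be an integer and let α > 0, m > 0, M > 0, F > 0, D > 0 be real constants. Then there exist constants β > 0 and C > 0, depending only on n, α, m, M, F, D, with the following property: for every bounded domain Ω ⊂ ℝ^n with diam(Ω) ≤ D, every f ∈ C²(Ω̄ × ℝ × ℝ^n) with f ≥ m and ‖f‖_{C²} ≤ F, and every u ∈ C⁴(Ω) ∩ C²(Ω̄) satisfying u = 0 on ∂Ω, λ(D²u(x)) ∈ Γ̃_n for all x ∈ Ω, σ_{n−1}(λ(D²u(x))) + α·σ_n(λ(D²u(x))) = f(x, u(x), Du(x)) in Ω, and ‖u‖_{C¹(Ω̄)} ≤ M, one has (−u(x))^β · Δu(x) ≤ C for all x ∈ Ω. (No lower bound on σ_n(D²u) is assumed.) -/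
open Finset

/-- The `j`-th elementary symmetric polynomial of `lam` restricted to the index set `A`,
with `σ_0 = 1` and `σ_j = 0` for `j < 0` or `j > |A|`. -/
noncomputable def esigma {n : ℕ} (A : Finset (Fin n)) (j : ℤ) (lam : Fin n → ℝ) : ℝ :=
  if 0 ≤ j then ∑ s ∈ A.powersetCard j.toNat, ∏ i ∈ s, lam i else 0

/-- The sum Hessian operator `S_j(λ) = σ_{j-1}(λ) + α σ_j(λ)` on the index set `A`. -/
noncomputable def Ssum {n : ℕ} (α : ℝ) (A : Finset (Fin n)) (j : ℤ) (lam : Fin n → ℝ) : ℝ :=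
  esigma A (j - 1) lam + α * esigma A j lam

/-- The Gårding cone `Γ_k`. -/
def Gamma (n k : ℕ) : Set (Fin n → ℝ) :=
  {lam | ∀ j : ℕ, 1 ≤ j → j ≤ k → 0 < esigma Finset.univ (j : ℤ) lam}

/-- The admissible cone `Γ̃_k = Γ_{k-1} ∩ {S_k > 0}`. -/
def GammaTilde (n k : ℕ) (α : ℝ) : Set (Fin n → ℝ) :=
  Gamma n (k - 1) ∩ {lam | 0 < Ssum α Finset.univ (k : ℤ) lam}

/-- The Hessian matrix `D²u(x)` of `u : ℝⁿ → ℝ`. -/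
noncomputable def hessianMat {n : ℕ} (u : EuclideanSpace ℝ (Fin n) → ℝ)
    (x : EuclideanSpace ℝ (Fin n)) : Matrix (Fin n) (Fin n) ℝ :=
  Matrix.of fun i j =>
    iteratedFDeriv ℝ 2 u x ![EuclideanSpace.single i 1, EuclideanSpace.single j 1]

/-- The gradient `Du(x)` of `u : ℝⁿ → ℝ`, as a vector in `ℝⁿ`. -/
noncomputable def gradVec {n : ℕ} (u : EuclideanSpace ℝ (Fin n) → ℝ)
    (x : EuclideanSpace ℝ (Fin n)) : EuclideanSpace ℝ (Fin n) :=
  (WithLp.equiv 2 (Fin n → ℝ)).symm fun i => fderiv ℝ u x (EuclideanSpace.single i 1)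

open scoped Topology

/-- The sum Hessian operator of top order, `σ_{|A|-1} + α σ_{|A|}` in the variables `lam i`,
`i ∈ A`. -/
noncomputable def sumSym {ι : Type*} [DecidableEq ι] (α : ℝ) (lam : ι → ℝ) (A : Finset ι) : ℝ :=
  ∑ i ∈ A, ∏ j ∈ A.erase i, lam j + α * ∏ i ∈ A, lam i

section SumSym

variable {ι : Type*} [DecidableEq ι] {α : ℝ} {lam : ι → ℝ} {A : Finset ι}

lemma sumSym_eq_erase {i : ι} (hi : i ∈ A) :
    sumSym α lam A = lam i * sumSym α lam (A.erase i) + ∏ j ∈ A.erase i, lam j := by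
  have h : ∀ k ∈ A.erase i,
      ∏ j ∈ A.erase k, lam j = lam i * ∏ j ∈ (A.erase i).erase k, lam j := by
    intro k hk
    rw [← Finset.mul_prod_erase (A.erase k) lam
      (mem_erase.2 ⟨(ne_of_mem_erase hk).symm, hi⟩), erase_right_comm]
  rw [sumSym, sumSym, ← Finset.add_sum_erase A _ hi, ← Finset.mul_prod_erase A lam hi,
    Finset.sum_congr rfl h, ← Finset.mul_sum]
  ring

lemma sumSym_eq_prod_mul (h : ∀ i ∈ A, lam i ≠ 0) :
    sumSym α lam A = (∏ i ∈ A, lam i) * (α + ∑ i ∈ A, (lam i)⁻¹) := by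
  rw [sumSym, mul_add, Finset.mul_sum, add_comm, mul_comm α]
  congr 1
  refine Finset.sum_congr rfl fun i hi => ?_
  rw [← Finset.mul_prod_erase A lam hi]
  field_simp [h i hi]

lemma prod_erase_eq (h : ∀ i ∈ A, lam i ≠ 0) {p : ι} (hp : p ∈ A) :
    ∏ i ∈ A.erase p, lam i = (∏ i ∈ A, lam i) * (lam p)⁻¹ := by
  rw [← Finset.mul_prod_erase A lam hp]
  field_simp [h p hp]

lemma sumSym_erase (h : ∀ i ∈ A, lam i ≠ 0) {p : ι} (hp : p ∈ A) :
    sumSym α lam (A.erase p) =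
      (∏ i ∈ A, lam i) * (lam p)⁻¹ * (α + ∑ i ∈ A, (lam i)⁻¹ - (lam p)⁻¹) := by
  rw [sumSym_eq_prod_mul fun i hi => h i (mem_of_mem_erase hi), prod_erase_eq h hp,
    ← Finset.add_sum_erase A _ hp]
  ring

lemma sumSym_erase_erase (h : ∀ i ∈ A, lam i ≠ 0) {p q : ι} (hp : p ∈ A) (hq : q ∈ A.erase p) :
    sumSym α lam ((A.erase p).erase q) = (∏ i ∈ A, lam i) * (lam p)⁻¹ * (lam q)⁻¹ *
      (α + ∑ i ∈ A, (lam i)⁻¹ - (lam p)⁻¹ - (lam q)⁻¹) := by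
  rw [sumSym_erase (fun i hi => h i (mem_of_mem_erase hi)) hq, prod_erase_eq h hp,
    ← Finset.add_sum_erase A _ hp]
  ring

lemma sumSym_pos_of_pos (hα : 0 < α) (h : ∀ i ∈ A, 0 < lam i) : 0 < sumSym α lam A := by
  rw [sumSym]
  have : 0 ≤ ∑ i ∈ A, ∏ j ∈ A.erase i, lam j :=
    Finset.sum_nonneg fun i _ => (Finset.prod_pos fun j hj => h j (mem_of_mem_erase hj)).le
  have := mul_pos hα (Finset.prod_pos h)
  linarith

lemma sum_sumSym_erase_erase_mul (h : ∀ i ∈ A, lam i ≠ 0) (ξ : ι → ℝ) :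
    ∑ p ∈ A, ∑ q ∈ A.erase p, sumSym α lam ((A.erase p).erase q) * (ξ p * ξ q) =
      (∏ i ∈ A, lam i) *
        ((α + ∑ i ∈ A, (lam i)⁻¹) * ((∑ i ∈ A, ξ i / lam i) ^ 2 - ∑ i ∈ A, (ξ i / lam i) ^ 2) -
        2 * ((∑ i ∈ A, (lam i)⁻¹ * (ξ i / lam i)) * (∑ i ∈ A, ξ i / lam i) -
          ∑ i ∈ A, (lam i)⁻¹ * (ξ i / lam i) ^ 2)) := by
  set s := α + ∑ i ∈ A, (lam i)⁻¹ with hs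
  set P := ∏ i ∈ A, lam i with hP
  have e : ∀ p ∈ A, ∑ q ∈ A.erase p, sumSym α lam ((A.erase p).erase q) * (ξ p * ξ q) =
      P * (s * (∑ q ∈ A, ξ q / lam q) * (ξ p / lam p) -
        (∑ q ∈ A, ξ q / lam q) * ((lam p)⁻¹ * (ξ p / lam p)) -
        (∑ q ∈ A, (lam q)⁻¹ * (ξ q / lam q)) * (ξ p / lam p) - s * (ξ p / lam p) ^ 2 +
        2 * ((lam p)⁻¹ * (ξ p / lam p) ^ 2)) := by
    intro p hp
    have e0 : ∑ q ∈ A.erase p, sumSym α lam ((A.erase p).erase q) * (ξ p * ξ q) =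
        ∑ q ∈ A.erase p, P * (s * (ξ p / lam p) * (ξ q / lam q) -
          (lam p)⁻¹ * (ξ p / lam p) * (ξ q / lam q) -
          (ξ p / lam p) * ((lam q)⁻¹ * (ξ q / lam q))) := by
      refine Finset.sum_congr rfl fun q hq => ?_
      rw [sumSym_erase_erase h hp hq]
      simp only [div_eq_mul_inv]; ring
    rw [e0, ← Finset.mul_sum, Finset.sum_sub_distrib, Finset.sum_sub_distrib, ← Finset.mul_sum,
      ← Finset.mul_sum, ← Finset.mul_sum, ← Finset.add_sum_erase A (fun q => ξ q / lam q) hp,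
      ← Finset.add_sum_erase A (fun q => (lam q)⁻¹ * (ξ q / lam q)) hp]
    ring
  rw [Finset.sum_congr rfl e, ← Finset.mul_sum, Finset.sum_add_distrib, Finset.sum_sub_distrib,
    Finset.sum_sub_distrib, Finset.sum_sub_distrib, ← Finset.mul_sum, ← Finset.mul_sum,
    ← Finset.mul_sum, ← Finset.mul_sum, ← Finset.mul_sum]
  ring

lemma sum_sumSym_erase_mul (h : ∀ i ∈ A, lam i ≠ 0) (ξ : ι → ℝ) :
    ∑ p ∈ A, sumSym α lam (A.erase p) * ξ p =
      (∏ i ∈ A, lam i) * ((α + ∑ i ∈ A, (lam i)⁻¹) * (∑ i ∈ A, ξ i / lam i) -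
        ∑ i ∈ A, (lam i)⁻¹ * (ξ i / lam i)) := by
  rw [Finset.mul_sum, ← Finset.sum_sub_distrib, Finset.mul_sum]
  refine Finset.sum_congr rfl fun p hp => ?_
  rw [sumSym_erase h hp]; simp only [div_eq_mul_inv]; ring

lemma sum_sumSym_erase_mul_sq (h : ∀ i ∈ A, lam i ≠ 0) (ξ : ι → ℝ) :
    ∑ p ∈ A, sumSym α lam (A.erase p) * ξ p ^ 2 =
      (∏ i ∈ A, lam i) * ((α + ∑ i ∈ A, (lam i)⁻¹) * (∑ i ∈ A, lam i * (ξ i / lam i) ^ 2) -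
        ∑ i ∈ A, (ξ i / lam i) ^ 2) := by
  rw [Finset.mul_sum, ← Finset.sum_sub_distrib, Finset.mul_sum]
  refine Finset.sum_congr rfl fun p hp => ?_
  rw [sumSym_erase h hp]
  have := h p hp
  field_simp

/-- The quadratic form in the third derivatives `ξ p = u_{ppo}` which arises on differentiating the
equation twice in the direction `o` of the largest eigenvalue. -/
noncomputable def thirdForm (α K : ℝ) (lam : ι → ℝ) (A : Finset ι) (o : ι) (ξ : ι → ℝ) : ℝ :=
  -(lam o * ∑ p ∈ A, ∑ q ∈ A.erase p, sumSym α lam ((A.erase p).erase q) * (ξ p * ξ q)) +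
    3 / 2 * ∑ q ∈ A.erase o, sumSym α lam (A.erase q) * ξ q ^ 2 -
    sumSym α lam (A.erase o) * ξ o ^ 2 +
    K * lam o * (∑ p ∈ A, sumSym α lam (A.erase p) * ξ p) ^ 2

lemma thirdForm_eq {K : ℝ} {o : ι} (ho : o ∈ A) (hne : ∀ i ∈ A, lam i ≠ 0) (ξ : ι → ℝ)
    {s h g v τ R Y Z L ζ a : ℝ} (hs : s = α + ∑ i ∈ A.erase o, (lam i)⁻¹) (hs0 : s ≠ 0)
    (hg : g = lam o) (hh : h = - s⁻¹) (hv : v = g - h)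
    (ha : a = sumSym α lam (A.erase o))
    (hτ : τ = ∑ i ∈ A.erase o, ξ i / lam i)
    (hR : R = ∑ i ∈ A.erase o, (lam i)⁻¹ * (ξ i / lam i))
    (hY : Y = ∑ i ∈ A.erase o, (ξ i / lam i) ^ 2)
    (hZ : Z = ∑ i ∈ A.erase o, (lam i)⁻¹ * (ξ i / lam i) ^ 2)
    (hL : L = ∑ i ∈ A.erase o, lam i * (ξ i / lam i) ^ 2)
    (hζ : ζ = ξ o + v * τ + g * h * R) :
    thirdForm α K lam A o ξ = a * (g ^ 2 * (h ^ 2 * R ^ 2 + 2 * h * Z + Y) + h * v * τ ^ 2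
      - h * g * Y + 3 / 2 * (v * L + g * h * Y) - ζ ^ 2 - 2 * h * τ * ζ + K * a * g * ζ ^ 2) := by
  have hgo : lam o ≠ 0 := hne o ho
  have ha' : a = (∏ i ∈ A.erase o, lam i) * s := by
    rw [ha, hs, sumSym_eq_prod_mul fun i hi => hne i (mem_of_mem_erase hi)]
  have e3 : ∑ q ∈ A.erase o, sumSym α lam (A.erase q) * ξ q ^ 2 =
      ∑ q ∈ A, sumSym α lam (A.erase q) * ξ q ^ 2 - sumSym α lam (A.erase o) * ξ o ^ 2 := by
    rw [← Finset.add_sum_erase A _ ho]; ring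
  rw [thirdForm, e3, sum_sumSym_erase_erase_mul hne, sum_sumSym_erase_mul_sq hne,
    sum_sumSym_erase_mul hne, ← ha]
  simp only [← Finset.add_sum_erase A _ ho, ← Finset.mul_prod_erase A _ ho]
  rw [← hτ, ← hR, ← hY, ← hZ, ← hL, ← hg, show α + (g⁻¹ + ∑ i ∈ A.erase o, (lam i)⁻¹) = s + g⁻¹ by
    rw [hs]; ring, ha', hζ, hv, hh]
  rw [← hg] at hgo
  generalize (∏ i ∈ A.erase o, lam i) = P
  field_simp
  ring
/-- Positivity of a rank-one perturbation of a diagonal quadratic form with nonnegative weights. -/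
lemma sq_sum_add_sum_one_sub_two_mul_nonneg (B : Finset ι) (p y : ι → ℝ) (hp : ∀ i ∈ B, 0 ≤ p i)
    (hs : ∑ i ∈ B, p i < 1) :
    0 ≤ (∑ i ∈ B, p i * y i) ^ 2 + ∑ i ∈ B, (1 - 2 * p i) * y i ^ 2 := by
  by_cases hall : ∀ i ∈ B, p i ≤ 1 / 2
  · have : 0 ≤ ∑ i ∈ B, (1 - 2 * p i) * y i ^ 2 :=
      Finset.sum_nonneg fun i hi => mul_nonneg (by linarith [hall i hi]) (sq_nonneg _)
    positivity
  push Not at hall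
  obtain ⟨k, hk, hk2⟩ := hall
  rw [← Finset.add_sum_erase B _ hk] at hs
  rw [← Finset.add_sum_erase B (fun i => p i * y i) hk,
    ← Finset.add_sum_erase B (fun i => (1 - 2 * p i) * y i ^ 2) hk]
  have hp' : ∀ i ∈ B.erase k, 0 ≤ p i := fun i hi => hp i (mem_of_mem_erase hi)
  set e := 1 - p k with he
  set z := ∑ i ∈ B.erase k, p i * y i with hz
  set Y := ∑ i ∈ B.erase k, y i ^ 2 with hY
  have hr : ∀ i ∈ B.erase k, p i ≤ e := fun i hi => by
    have := Finset.single_le_sum hp' hi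
    linarith
  have hYnn : 0 ≤ Y := Finset.sum_nonneg fun i _ => sq_nonneg _
  have h0 : 0 ≤ ∑ i ∈ B.erase k, p i := Finset.sum_nonneg hp'
  have h1 : (1 - 2 * e) * Y ≤ ∑ i ∈ B.erase k, (1 - 2 * p i) * y i ^ 2 := by
    rw [hY, Finset.mul_sum]
    exact Finset.sum_le_sum fun i hi =>
      mul_le_mul_of_nonneg_right (by linarith [hr i hi]) (sq_nonneg _)
  have h2 : z ^ 2 ≤ e ^ 2 * Y := by
    have h3 : z ^ 2 ≤ (∑ i ∈ B.erase k, p i ^ 2) * Y := Finset.sum_mul_sq_le_sq_mul_sq _ _ _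
    have h4 : ∑ i ∈ B.erase k, p i ^ 2 ≤ e ^ 2 := by
      calc ∑ i ∈ B.erase k, p i ^ 2 ≤ ∑ i ∈ B.erase k, e * p i :=
            Finset.sum_le_sum fun i hi => by
              rw [sq]; exact mul_le_mul_of_nonneg_right (hr i hi) (hp' i hi)
        _ = e * ∑ i ∈ B.erase k, p i := by rw [Finset.mul_sum]
        _ ≤ e ^ 2 := by rw [sq]; exact mul_le_mul_of_nonneg_left (by linarith) (by linarith)
    exact h3.trans (mul_le_mul_of_nonneg_right h4 hYnn)
  have hepos : 0 < e := by linarith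
  have hpk : p k = 1 - e := by ring
  have hpk2 : 0 ≤ 1 - 2 * e := by linarith
  suffices h : 0 ≤ e ^ 2 * ((p k * y k + z) ^ 2 + ((1 - 2 * p k) * y k ^ 2 + (1 - 2 * e) * Y)) by
    have := nonneg_of_mul_nonneg_right h (by positivity)
    linarith
  rw [hpk]
  nlinarith [mul_le_mul_of_nonneg_left h2 hpk2, sq_nonneg (e ^ 2 * y k + (1 - e) * z)]

/-- The Lorentzian counterpart of `sq_sum_add_sum_one_sub_two_mul_nonneg`. -/
lemma sq_sub_sum_add_sum_one_add_two_mul_nonneg {ι : Type*} (B : Finset ι) (q y : ι → ℝ)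
    (hq : ∀ i ∈ B, 0 ≤ q i) {e x : ℝ} (he : ∑ i ∈ B, q i ≤ e) (he0 : 0 < e) :
    0 ≤ ((1 + e) * x - ∑ i ∈ B, q i * y i) ^ 2 - (1 + 2 * e) * x ^ 2 +
      ∑ i ∈ B, (1 + 2 * q i) * y i ^ 2 := by
  set z := ∑ i ∈ B, q i * y i with hz
  set V := ∑ i ∈ B, (1 + 2 * q i) * y i ^ 2 with hV
  have hVnn : 0 ≤ V := Finset.sum_nonneg fun i hi => by have := hq i hi; positivity
  have h1 : z ^ 2 ≤ (∑ i ∈ B, q i ^ 2 / (1 + 2 * q i)) * V := by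
    refine Finset.sum_sq_le_sum_mul_sum_of_sq_le_mul _ (fun i hi => ?_) (fun i hi => ?_)
      fun i hi => ?_
    · have := hq i hi; positivity
    · have := hq i hi; positivity
    · have := hq i hi; exact le_of_eq (by field_simp)
  have h2 : ∑ i ∈ B, q i ^ 2 / (1 + 2 * q i) ≤ e ^ 2 / (1 + 2 * e) := by
    calc ∑ i ∈ B, q i ^ 2 / (1 + 2 * q i) ≤ ∑ i ∈ B, e / (1 + 2 * e) * q i :=
          Finset.sum_le_sum fun i hi => by
            have h0 := hq i hi
            have h3 : q i ≤ e := (Finset.single_le_sum hq hi).trans he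
            rw [div_mul_eq_mul_div, div_le_div_iff₀ (by positivity) (by positivity)]
            nlinarith [mul_nonneg h0 (sub_nonneg.2 h3)]
      _ = e / (1 + 2 * e) * ∑ i ∈ B, q i := by rw [Finset.mul_sum]
      _ ≤ e / (1 + 2 * e) * e := mul_le_mul_of_nonneg_left he (by positivity)
      _ = e ^ 2 / (1 + 2 * e) := by ring
  have h3 : (1 + 2 * e) * z ^ 2 ≤ e ^ 2 * V := by
    have := h1.trans (mul_le_mul_of_nonneg_right h2 hVnn)
    rw [div_mul_eq_mul_div, le_div_iff₀ (by positivity)] at this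
    linarith
  suffices h : 0 ≤ e ^ 2 * (((1 + e) * x - z) ^ 2 - (1 + 2 * e) * x ^ 2 + V) from
    nonneg_of_mul_nonneg_right h (by positivity)
  nlinarith [sq_nonneg (e ^ 2 * x - (1 + e) * z)]

/-- A completion of squares used for a form with one negative direction. -/
lemma mul_sq_le_add_of_sq_le_mul {w h r x t τ L : ℝ} (hh : 0 < h) (hw : 0 < w) (hr : 0 ≤ r)
    (hL : 0 ≤ L) (h1 : t ^ 2 ≤ r * L) (h2 : w * (1 + h * r) ≤ h) (hτ : τ = x + t) :
    w * x ^ 2 ≤ h * τ ^ 2 + L := by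
  have h4 : h * x ^ 2 ≤ (1 + h * r) * (h * τ ^ 2 + L) := by
    rcases hr.eq_or_lt with h0 | h0
    · rw [← h0] at h1 ⊢
      have : t = 0 := by nlinarith [sq_nonneg t]
      rw [hτ, this]; nlinarith
    · have h5 : 0 ≤ r * ((1 + h * r) * (h * τ ^ 2 + L) - h * x ^ 2) := by
        have : x = τ - t := by rw [hτ]; ring
        rw [this]
        have h6 := mul_le_mul_of_nonneg_left h1 (by positivity : 0 ≤ 1 + h * r)
        nlinarith [sq_nonneg (h * r * τ + t)]
      have := nonneg_of_mul_nonneg_right h5 h0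
      linarith
  have h7 : 0 ≤ h * τ ^ 2 + L := by positivity
  have h8 := mul_le_mul_of_nonneg_left h4 hw.le
  have h9 := mul_le_mul_of_nonneg_right h2 h7
  have h10 : h * (w * x ^ 2) ≤ h * (h * τ ^ 2 + L) := by linarith
  exact le_of_mul_le_mul_left h10 hh

lemma thirdForm_nonneg_of_pos {K m : ℝ} {o : ι} (hα : 0 < α) (hm : 0 < m) (ho : o ∈ A)
    (hpos : ∀ i ∈ A, 0 < lam i) (hS : m ≤ sumSym α lam A) (hg : 2 ≤ α * lam o)
    (hK : 2 * (1 + 2 * A.card) ≤ K * m) (ξ : ι → ℝ) :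
    0 ≤ thirdForm α K lam A o ξ := by
  have hsum : 0 ≤ ∑ i ∈ A.erase o, (lam i)⁻¹ :=
    Finset.sum_nonneg fun i hi => (inv_pos.2 (hpos i (mem_of_mem_erase hi))).le
  obtain ⟨s, hs⟩ : ∃ s, s = α + ∑ i ∈ A.erase o, (lam i)⁻¹ := ⟨_, rfl⟩
  have hspos : 0 < s := by linarith
  obtain ⟨k, hk⟩ : ∃ k, k = s⁻¹ := ⟨_, rfl⟩
  have hkpos : 0 < k := by rw [hk]; positivity
  have hks : k * s = 1 := by rw [hk]; field_simp
  obtain ⟨g, hgg⟩ : ∃ g, g = lam o := ⟨_, rfl⟩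
  have hgpos : 0 < g := by rw [hgg]; exact hpos o ho
  have hne : ∀ i ∈ A, lam i ≠ 0 := fun i hi => (hpos i hi).ne'
  have hpos' : ∀ i ∈ A.erase o, 0 < lam i := fun i hi => hpos i (mem_of_mem_erase hi)
  have hapos : 0 < sumSym α lam (A.erase o) := sumSym_pos_of_pos hα hpos'
  rw [thirdForm_eq (α := α) (lam := lam) (A := A) (K := K) ho hne ξ hs hspos.ne' hgg
    (h := -k) (by rw [hk]) rfl rfl rfl rfl rfl rfl rfl rfl]
  refine mul_nonneg hapos.le ?_
  obtain ⟨a, ha⟩ : ∃ a, a = sumSym α lam (A.erase o) := ⟨_, rfl⟩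
  have hag : m ≤ 2 * (a * g) := by
    have h1 := sumSym_eq_erase (α := α) (lam := lam) ho
    have h2 := sumSym_eq_prod_mul (α := α) (A := A.erase o) fun i hi => (hpos' i hi).ne'
    have h3 : 0 < ∏ i ∈ A.erase o, lam i := Finset.prod_pos hpos'
    rw [← hs, ← ha] at h2
    rw [← ha, ← hgg] at h1
    have h4 : 1 ≤ g * s := by rw [hgg] ; nlinarith
    nlinarith
  rw [← ha]
  set τ := ∑ i ∈ A.erase o, ξ i / lam i with hτ
  set R := ∑ i ∈ A.erase o, (lam i)⁻¹ * (ξ i / lam i) with hR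
  set Y := ∑ i ∈ A.erase o, (ξ i / lam i) ^ 2 with hY
  set Z := ∑ i ∈ A.erase o, (lam i)⁻¹ * (ξ i / lam i) ^ 2 with hZ
  set L := ∑ i ∈ A.erase o, lam i * (ξ i / lam i) ^ 2 with hL
  generalize ξ o + (g - -k) * τ + g * -k * R = ζ
  have hBr : 0 ≤ k ^ 2 * R ^ 2 - 2 * k * Z + Y := by
    have := sq_sum_add_sum_one_sub_two_mul_nonneg (A.erase o) (fun i => k * (lam i)⁻¹)
      (fun i => ξ i / lam i) (fun i hi => (mul_pos hkpos (inv_pos.2 (hpos' i hi))).le)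
      (by rw [← Finset.mul_sum]; nlinarith)
    convert this using 1
    simp only [mul_assoc, sub_mul, one_mul, Finset.sum_sub_distrib, ← Finset.mul_sum]
    rw [← hR, ← hY, ← hZ]
    ring
  have hLk : k * Y ≤ L := by
    rw [hY, hL, Finset.mul_sum]
    refine Finset.sum_le_sum fun i hi => mul_le_mul_of_nonneg_right ?_ (sq_nonneg _)
    have h1 : (lam i)⁻¹ ≤ s := by
      have := Finset.single_le_sum (f := fun i => (lam i)⁻¹)
        (fun i hi => (inv_pos.2 (hpos' i hi)).le) hi
      linarith
    rw [hk]
    exact inv_le_of_inv_le₀ (hpos' i hi) h1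
  have hCS : τ ^ 2 ≤ (s - α) * L := by
    rw [hs, add_sub_cancel_left]
    refine Finset.sum_sq_le_sum_mul_sum_of_sq_le_mul _ (fun i hi => ?_) (fun i hi => ?_)
      fun i hi => ?_
    · exact (inv_pos.2 (hpos' i hi)).le
    · have := hpos' i hi; positivity
    · have := (hpos' i hi).ne'; exact le_of_eq (by field_simp)
  have hLnn : 0 ≤ L := Finset.sum_nonneg fun i hi => by have := hpos' i hi; positivity
  have hCS2 : k * (1 + α * k) * τ ^ 2 ≤ L := by
    have h1 : k * τ ^ 2 ≤ (1 - α * k) * L := by nlinarith [mul_le_mul_of_nonneg_left hCS hkpos.le]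
    have h2 : 0 ≤ 1 + α * k := by positivity
    nlinarith [mul_le_mul_of_nonneg_left h1 h2, mul_nonneg (sq_nonneg (α * k)) hLnn]
  have hg2 : 2 ≤ α * g := by rw [hgg]; exact hg
  have hKag : 2 ≤ K * (a * g) := by
    have hc : (1 : ℝ) ≤ A.card := by exact_mod_cast Finset.card_pos.2 ⟨o, ho⟩
    have hKpos : 0 < K := pos_of_mul_pos_left (by linarith) hm.le
    nlinarith
  have hmain : k ^ 2 * τ ^ 2 ≤ -k * (g + k) * τ ^ 2 + k * g * Y
      + 3 / 2 * ((g + k) * L - g * k * Y) := by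
    have h1 : g * L ≤ k * g * Y + 3 / 2 * ((g + k) * L - g * k * Y) := by
      nlinarith [mul_le_mul_of_nonneg_left hLk hgpos.le, mul_nonneg hkpos.le hLnn]
    have h2 := mul_le_mul_of_nonneg_left hCS2 hgpos.le
    have h3 : 0 ≤ (α * g - 2) * (k ^ 2 * τ ^ 2) := mul_nonneg (by linarith) (by positivity)
    nlinarith
  linarith [mul_nonneg (sq_nonneg g) hBr, sq_nonneg (k * τ + ζ),
    mul_le_mul_of_nonneg_right hKag (sq_nonneg ζ)]

set_option maxHeartbeats 1000000 in
lemma thirdForm_nonneg_of_neg {K m : ℝ} {o l : ι} (hα : 0 < α) (hm : 0 < m) (ho : o ∈ A)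
    (hl : l ∈ A.erase o) (hneg : lam l < 0)
    (hpos : ∀ i ∈ A, i ≠ l → 0 < lam i) (hS : m ≤ sumSym α lam A)
    (hK : 2 * (1 + 2 * A.card) ≤ K * m) (ξ : ι → ℝ) :
    0 ≤ thirdForm α K lam A o ξ := by
  have hlo : l ≠ o := ne_of_mem_erase hl
  have hlA : l ∈ A := mem_of_mem_erase hl
  obtain ⟨g, hgg⟩ : ∃ g, g = lam o := ⟨_, rfl⟩
  have hgpos : 0 < g := by rw [hgg]; exact hpos o ho hlo.symm
  obtain ⟨w, hw⟩ : ∃ w, w = -lam l := ⟨_, rfl⟩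
  have hwpos : 0 < w := by linarith
  have hne : ∀ i ∈ A, lam i ≠ 0 := fun i hi => by
    by_cases h : i = l
    · rw [h]; exact hneg.ne
    · exact (hpos i hi h).ne'
  have hpos' : ∀ i ∈ (A.erase o).erase l, 0 < lam i := fun i hi =>
    hpos i (mem_of_mem_erase (mem_of_mem_erase hi)) (ne_of_mem_erase hi)
  obtain ⟨r, hr⟩ : ∃ r, r = ∑ i ∈ (A.erase o).erase l, (lam i)⁻¹ := ⟨_, rfl⟩
  have hrnn : 0 ≤ r := by
    rw [hr]; exact Finset.sum_nonneg fun i hi => (inv_pos.2 (hpos' i hi)).le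
  obtain ⟨s, hs⟩ : ∃ s, s = α + ∑ i ∈ A.erase o, (lam i)⁻¹ := ⟨_, rfl⟩
  have hsr : s = α + r - w⁻¹ := by
    rw [hs, ← Finset.add_sum_erase _ _ hl, ← hr, hw, inv_neg]; ring
  obtain ⟨a, ha⟩ : ∃ a, a = sumSym α lam (A.erase o) := ⟨_, rfl⟩
  have hP : 0 < ∏ i ∈ (A.erase o).erase l, lam i := Finset.prod_pos hpos'
  have hB : ∏ i ∈ A.erase o, lam i = -(w * ∏ i ∈ (A.erase o).erase l, lam i) := by
    rw [← Finset.mul_prod_erase _ _ hl, hw]; ring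
  have hBneg : ∏ i ∈ A.erase o, lam i < 0 := by rw [hB]; nlinarith
  have hSa := sumSym_eq_erase (α := α) (lam := lam) ho
  rw [← ha, ← hgg] at hSa
  have has : a = (∏ i ∈ A.erase o, lam i) * s := by
    rw [ha, hs, sumSym_eq_prod_mul fun i hi => hne i (mem_of_mem_erase hi)]
  have hag : m ≤ a * g := by nlinarith
  have hapos : 0 < a := pos_of_mul_pos_left (by linarith) hgpos.le
  have hsneg : s < 0 := by
    by_contra hcon
    nlinarith
  obtain ⟨h, hh⟩ : ∃ h, h = -s⁻¹ := ⟨_, rfl⟩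
  have hhpos : 0 < h := by rw [hh]; linarith [inv_lt_zero.2 hsneg]
  have hhs : h * s = -1 := by rw [hh]; field_simp [hsneg.ne]
  have hvpos : 0 < g - h := by
    have h1 : g * s + 1 < 0 := by
      by_contra hcon
      nlinarith
    nlinarith
  rw [thirdForm_eq (α := α) (lam := lam) (A := A) (K := K) ho hne ξ hs hsneg.ne hgg
    hh rfl rfl rfl rfl rfl rfl rfl rfl, ← ha]
  refine mul_nonneg hapos.le ?_
  obtain ⟨v, hv⟩ : ∃ v, v = g - h := ⟨_, rfl⟩
  rw [← hv] at hvpos ⊢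
  set τ := ∑ i ∈ A.erase o, ξ i / lam i with hτ
  set R := ∑ i ∈ A.erase o, (lam i)⁻¹ * (ξ i / lam i) with hR
  set Y := ∑ i ∈ A.erase o, (ξ i / lam i) ^ 2 with hY
  set Z := ∑ i ∈ A.erase o, (lam i)⁻¹ * (ξ i / lam i) ^ 2 with hZ
  set L := ∑ i ∈ A.erase o, lam i * (ξ i / lam i) ^ 2 with hL
  generalize ξ o + v * τ + g * h * R = ζ
  have hhw : h * w⁻¹ = 1 + (h * α + h * r) := by
    rw [hsr] at hhs; linarith
  have hhw' : w ≤ h := by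
    have h1 : 1 ≤ h * w⁻¹ := by rw [hhw]; nlinarith
    rwa [← div_eq_mul_inv, one_le_div hwpos] at h1
  have hBr : 0 ≤ h ^ 2 * R ^ 2 + 2 * h * Z + Y := by
    have := sq_sub_sum_add_sum_one_add_two_mul_nonneg ((A.erase o).erase l)
      (fun i => h * (lam i)⁻¹) (fun i => ξ i / lam i)
      (fun i hi => (mul_pos hhpos (inv_pos.2 (hpos' i hi))).le)
      (e := h * α + h * r) (x := ξ l / lam l)
      (by rw [← Finset.mul_sum, ← hr]; nlinarith) (by nlinarith)
    convert this using 1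
    simp only [mul_assoc, add_mul, one_mul, Finset.sum_add_distrib, ← Finset.mul_sum]
    rw [hR, hY, hZ, ← Finset.add_sum_erase _ _ hl, ← Finset.add_sum_erase _ _ hl,
      ← Finset.add_sum_erase _ _ hl]
    have e1 : h * (lam l)⁻¹ = -(1 + (h * α + h * r)) := by
      rw [← hhw, hw, inv_neg]; ring
    linear_combination ((h * (lam l)⁻¹ - (1 + (h * α + h * r))) * (ξ l / lam l) ^ 2 +
      2 * (ξ l / lam l) * h * (∑ i ∈ (A.erase o).erase l, (lam i)⁻¹ * (ξ i / lam i)) +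
      2 * (ξ l / lam l) ^ 2) * e1
  have hYnn : 0 ≤ Y := Finset.sum_nonneg fun i _ => sq_nonneg _
  have hCS : 0 ≤ h * τ ^ 2 + 1 / 2 * h * Y + 3 / 2 * L := by
    set x := ξ l / lam l with hx
    set t := ∑ i ∈ (A.erase o).erase l, ξ i / lam i with ht
    set L' := ∑ i ∈ (A.erase o).erase l, lam i * (ξ i / lam i) ^ 2 with hL'
    set Y' := ∑ i ∈ (A.erase o).erase l, (ξ i / lam i) ^ 2 with hY'
    have e1 : τ = x + t := by rw [hτ, ← Finset.add_sum_erase _ _ hl]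
    have e2 : L = -w * x ^ 2 + L' := by
      rw [hL, ← Finset.add_sum_erase _ _ hl, hw]; ring
    have e3 : Y = x ^ 2 + Y' := by rw [hY, ← Finset.add_sum_erase _ _ hl]
    have h1 : t ^ 2 ≤ r * L' := by
      rw [hr]
      refine Finset.sum_sq_le_sum_mul_sum_of_sq_le_mul _ (fun i hi => ?_) (fun i hi => ?_)
        fun i hi => ?_
      · exact (inv_pos.2 (hpos' i hi)).le
      · have := hpos' i hi; positivity
      · have := (hpos' i hi).ne'; exact le_of_eq (by field_simp)
    have hL'nn : 0 ≤ L' := Finset.sum_nonneg fun i hi => by have := hpos' i hi; positivity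
    have hY'nn : 0 ≤ Y' := Finset.sum_nonneg fun i _ => sq_nonneg _
    have h2 : w * (1 + h * r) ≤ h := by
      have : w * (h * w⁻¹) = h := by field_simp
      rw [hhw] at this
      nlinarith [mul_pos (mul_pos hwpos hhpos) hα]
    have h3 : w * x ^ 2 ≤ h * τ ^ 2 + L' :=
      mul_sq_le_add_of_sq_le_mul hhpos hwpos hrnn hL'nn h1 h2 e1
    rw [e2, e3]
    nlinarith [mul_le_mul_of_nonneg_right hhw' (sq_nonneg x), mul_nonneg hhpos.le hY'nn]
  have hcard : (0 : ℝ) < A.card := by exact_mod_cast Finset.card_pos.2 ⟨o, ho⟩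
  have hτY : τ ^ 2 ≤ A.card * Y := by
    have h1 : τ ^ 2 ≤ (A.erase o).card * Y := sq_sum_le_card_mul_sum_sq
    have h2 : ((A.erase o).card : ℝ) ≤ A.card := by exact_mod_cast Finset.card_erase_le
    nlinarith
  have hKag : 1 + 2 * A.card ≤ K * (a * g) := by
    have hKpos : 0 < K := pos_of_mul_pos_left (by linarith) hm.le
    nlinarith
  have hfin : 0 ≤ 1 / 2 * h ^ 2 * Y - 2 * h * τ * ζ + 2 * A.card * ζ ^ 2 := by
    have h1 : 0 ≤ A.card * (1 / 2 * h ^ 2 * Y - 2 * h * τ * ζ + 2 * A.card * ζ ^ 2) := by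
      nlinarith [mul_le_mul_of_nonneg_left hτY (by positivity : 0 ≤ 1 / 2 * h ^ 2),
        sq_nonneg (h * τ - 2 * A.card * ζ)]
    exact nonneg_of_mul_nonneg_right h1 hcard
  have hgv : g = v + h := by rw [hv]; ring
  have hgY : 1 / 2 * h * g * Y = 1 / 2 * h ^ 2 * Y + 1 / 2 * h * v * Y := by rw [hgv]; ring
  linarith [mul_nonneg (sq_nonneg g) hBr, mul_nonneg hvpos.le hCS,
    mul_le_mul_of_nonneg_right hKag (sq_nonneg ζ)]
end SumSym

section Cone

variable {ι : Type*} [DecidableEq ι] {α : ℝ} {lam : ι → ℝ} {A : Finset ι}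

lemma sumSym_congr {lam' : ι → ℝ} (h : ∀ i ∈ A, lam i = lam' i) :
    sumSym α lam A = sumSym α lam' A := by
  rw [sumSym, sumSym, Finset.prod_congr rfl h]
  congr 1
  exact Finset.sum_congr rfl fun i _ => Finset.prod_congr rfl fun j hj => h j (mem_of_mem_erase hj)

lemma sumSym_update_continuous {l : ι} :
    Continuous fun t : ℝ => sumSym α (Function.update lam l t) A := by
  unfold sumSym
  have : ∀ i, Continuous fun t : ℝ => Function.update lam l t i := fun i => by
    by_cases h : i = l
    · subst h; simpa using continuous_id'
    · simpa [h] using continuous_const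
  fun_prop

lemma thirdForm_nonneg_of_zero {K m : ℝ} {o l : ι} (hα : 0 < α) (hm : 0 < m) (ho : o ∈ A)
    (hl : l ∈ A.erase o) (hzero : lam l = 0) (hpos : ∀ i ∈ A, i ≠ l → 0 < lam i)
    (hS : m ≤ sumSym α lam A) (hg : 2 ≤ α * lam o) (hK : 2 * (1 + 2 * A.card) ≤ K * m)
    (ξ : ι → ℝ) : 0 ≤ thirdForm α K lam A o ξ := by
  have hlA : l ∈ A := mem_of_mem_erase hl
  have hlo : o ≠ l := (ne_of_mem_erase hl).symm
  have hcont : Continuous fun t : ℝ => thirdForm α K (Function.update lam l t) A o ξ := by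
    unfold thirdForm
    have := fun B : Finset ι => sumSym_update_continuous (α := α) (lam := lam) (A := B) (l := l)
    have h2 : Continuous fun t : ℝ => Function.update lam l t o := by
      simpa [hlo] using continuous_const
    fun_prop
  have h0 : Function.update lam l 0 = lam := by rw [← hzero, Function.update_eq_self]
  have hev : ∀ t : ℝ, 0 < t → 0 ≤ thirdForm α K (Function.update lam l t) A o ξ := by
    intro t ht
    have hu : ∀ i ∈ A.erase l, Function.update lam l t i = lam i := fun i hi =>
      Function.update_of_ne (ne_of_mem_erase hi) _ _
    refine thirdForm_nonneg_of_pos hα hm ho (fun i hi => ?_) ?_ ?_ hK ξ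
    · by_cases h : i = l
      · simpa [h] using ht
      · simpa [h] using hpos i hi h
    · refine hS.trans ?_
      rw [sumSym_eq_erase hlA, sumSym_eq_erase hlA, sumSym_congr hu, Finset.prod_congr rfl hu,
        hzero, Function.update_self]
      have : 0 < sumSym α lam (A.erase l) :=
        sumSym_pos_of_pos hα fun i hi => hpos i (mem_of_mem_erase hi) (ne_of_mem_erase hi)
      nlinarith
    · simpa [hlo] using hg
  have hlim := (hcont.tendsto 0).mono_left (nhdsWithin_le_nhds (s := Set.Ioi 0))
  rw [h0] at hlim
  exact ge_of_tendsto hlim (by filter_upwards [self_mem_nhdsWithin] with t ht using hev t ht)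

lemma thirdForm_nonneg {K m : ℝ} {o : ι} (hα : 0 < α) (hm : 0 < m) (ho : o ∈ A)
    (hpos : ∀ i j, i ≠ j → lam i ≤ 0 → 0 < lam j)
    (hS : m ≤ sumSym α lam A) (hg : 2 ≤ α * lam o) (hK : 2 * (1 + 2 * A.card) ≤ K * m)
    (ξ : ι → ℝ) : 0 ≤ thirdForm α K lam A o ξ := by
  by_cases hall : ∀ i ∈ A, 0 < lam i
  · exact thirdForm_nonneg_of_pos hα hm ho hall hS hg hK ξ
  push Not at hall
  obtain ⟨l, hl, hl0⟩ := hall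
  have hlo : l ≠ o := by rintro rfl; nlinarith
  rcases hl0.eq_or_lt with h0 | h0
  · exact thirdForm_nonneg_of_zero hα hm ho (mem_erase.2 ⟨hlo, hl⟩) h0
      (fun i _ hil => hpos l i hil.symm hl0) hS hg hK ξ
  · exact thirdForm_nonneg_of_neg hα hm ho (mem_erase.2 ⟨hlo, hl⟩) h0
      (fun i _ hil => hpos l i hil.symm hl0) hS hK ξ

lemma sumSym_pos_of_univ [Fintype ι] (hα : 0 < α)
    (hpos : ∀ i j, i ≠ j → lam i ≤ 0 → 0 < lam j)
    (hS : 0 < sumSym α lam univ) (A : Finset ι) : 0 < sumSym α lam A := by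
  by_cases hall : ∀ i ∈ A, 0 < lam i
  · exact sumSym_pos_of_pos hα hall
  push Not at hall
  obtain ⟨l, hl, hl0⟩ := hall
  have key : ∀ T : Finset ι, l ∉ T → 0 < sumSym α lam Tᶜ := by
    intro T
    induction T using Finset.induction_on with
    | empty => intro _; simpa using hS
    | insert k T hk ih =>
      intro hlT
      rw [mem_insert, not_or] at hlT
      have h1 := ih hlT.2
      rw [sumSym_eq_erase (i := k) (by simpa using hk), ← compl_insert] at h1
      have h2 : ∏ j ∈ (insert k T)ᶜ, lam j ≤ 0 := by
        have hmem : l ∈ (insert k T)ᶜ := by simp [hlT.1, hlT.2]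
        rw [← Finset.mul_prod_erase _ _ hmem]
        exact mul_nonpos_of_nonpos_of_nonneg hl0 (Finset.prod_nonneg fun i hi =>
          (hpos l i (ne_of_mem_erase hi).symm hl0).le)
      exact pos_of_mul_pos_right (b := sumSym α lam (insert k T)ᶜ) (by linarith)
        (hpos l k hlT.1 hl0).le
  simpa using key Aᶜ (by simpa using hl)

open Polynomial in
lemma natDegree_prod_X_add_C {ι : Type*} (lam : ι → ℝ) (A : Finset ι) :
    (∏ i ∈ A, (X + C (lam i))).natDegree = A.card := by
  rw [Polynomial.natDegree_prod_of_monic _ _ fun i _ => Polynomial.monic_X_add_C _]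
  simp

open Polynomial in
lemma sumSym_eq_coeff : sumSym α lam A =
    (∏ i ∈ A, (X + C (lam i))).coeff 1 + α * (∏ i ∈ A, (X + C (lam i))).coeff 0 := by
  have h1 : (∏ i ∈ A, (X + C (lam i))).coeff 1 = (∏ i ∈ A, (X + C (lam i))).derivative.coeff 0 := by
    rw [Polynomial.coeff_derivative]; simp
  rw [h1, Polynomial.coeff_zero_eq_eval_zero, Polynomial.coeff_zero_eq_eval_zero,
    Polynomial.derivative_prod_finset]
  simp [sumSym, Polynomial.eval_prod, Polynomial.eval_finsetSum]

open Polynomial in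
/-- The sum Hessian operator is a fixed linear combination of values of the characteristic
polynomial. -/
lemma exists_sumSym_eq_sum_prod (n : ℕ) (α : ℝ) : ∃ d s : Fin (n + 1) → ℝ,
    ∀ (lam : Fin n → ℝ) (A : Finset (Fin n)),
      sumSym α lam A = ∑ k, d k * ∏ i ∈ A, (lam i + s k) := by
  let v : Fin (n + 1) → ℝ := fun k => (k : ℕ)
  have hv : Function.Injective v := fun a b h => Fin.ext (Nat.cast_injective (R := ℝ) h)
  refine ⟨fun k => (Lagrange.basis univ v k).coeff 1 + α * (Lagrange.basis univ v k).coeff 0,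
    v, fun lam A => ?_⟩
  have hdeg : (∏ i ∈ A, (X + C (lam i))).degree <
      ((univ : Finset (Fin (n + 1))).card : WithBot ℕ) := by
    refine lt_of_le_of_lt Polynomial.degree_le_natDegree ?_
    rw [natDegree_prod_X_add_C, card_univ, Fintype.card_fin]
    exact_mod_cast Nat.lt_succ_of_le ((card_le_univ A).trans (by simp))
  rw [sumSym_eq_coeff, Lagrange.eq_interpolate hv.injOn hdeg, Lagrange.interpolate_apply]
  simp only [Polynomial.finsetSum_coeff, Polynomial.coeff_C_mul, Polynomial.eval_prod,
    Polynomial.eval_add, Polynomial.eval_X, Polynomial.eval_C, Finset.mul_sum,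
    ← Finset.sum_add_distrib]
  refine Finset.sum_congr rfl fun k _ => ?_
  simp only [add_comm (v k)]
  ring

end Cone

section GammaTilde

variable {n : ℕ} {α : ℝ} {lam : Fin n → ℝ}

open Polynomial in
lemma esigma_univ_eq_coeff {j : ℕ} (hj : j ≤ n) :
    esigma univ (j : ℤ) lam = (∏ i, (X + C (lam i))).coeff (n - j) := by
  rw [Finset.prod_X_add_C_coeff _ _ (by simp)]
  simp [esigma, Nat.sub_sub_self hj]

lemma Ssum_univ_eq_sumSym (hn : 1 ≤ n) : Ssum α univ (n : ℤ) lam = sumSym α lam univ := by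
  rw [Ssum, sumSym_eq_coeff, esigma_univ_eq_coeff le_rfl,
    show (n : ℤ) - 1 = ((n - 1 : ℕ) : ℤ) by omega, esigma_univ_eq_coeff (by omega)]
  simp [Nat.sub_sub_self hn]

lemma sum_prod_erase_pos (hn : 2 ≤ n) (h : lam ∈ Gamma n (n - 1)) :
    0 < ∑ i, ∏ j ∈ univ.erase i, lam j := by
  have h1 := h (n - 1) (by omega) le_rfl
  have h2 := sumSym_eq_coeff (α := 0) (lam := lam) (A := univ)
  rw [esigma_univ_eq_coeff (by omega), Nat.sub_sub_self (by omega)] at h1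
  rw [sumSym] at h2
  linarith

open Polynomial in
/-- A vector in the Gårding cone `Γ_{n-1}` has at most one nonpositive entry. -/
lemma pos_of_mem_Gamma (hn : 2 ≤ n) (h : lam ∈ Gamma n (n - 1)) (i j : Fin n)
    (hij : i ≠ j) (hi : lam i ≤ 0) : 0 < lam j := by
  by_contra! hj
  set p : ℝ[X] := ∏ i, (X + C (lam i)) with hp
  have hdeg : p.natDegree = n := by
    rw [hp, natDegree_prod_X_add_C]; simp
  have hcoeff : ∀ k, 1 ≤ k → k ≤ n → 0 < p.coeff k := by
    intro k hk1 hk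
    rcases hk.eq_or_lt with rfl | hk2
    · have : p.coeff p.natDegree = 1 := by
        rw [Polynomial.coeff_natDegree]; 
        exact Polynomial.monic_prod_of_monic _ _ fun i _ => Polynomial.monic_X_add_C _
      rw [hdeg] at this
      rw [this]; exact one_pos
    · have h1 := h (n - k) (by omega) (by omega)
      rwa [esigma_univ_eq_coeff (by omega), Nat.sub_sub_self hk] at h1
  have hd : ∀ t : ℝ, 0 ≤ t → 0 < p.derivative.eval t := by
    intro t ht
    rw [Polynomial.derivative_eval, Polynomial.sum_over_range' _ (by simp) (n + 1) (by omega)]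
    refine Finset.sum_pos' (fun k hk => ?_) ⟨1, by simp; omega, ?_⟩
    · rcases Nat.eq_zero_or_pos k with rfl | hk0
      · simp
      · have := hcoeff k hk0 (by simpa [Nat.lt_succ_iff] using hk)
        positivity
    · simpa using hcoeff 1 le_rfl (by omega)
  have hroot : ∀ k, p.eval (-lam k) = 0 := fun k => by
    rw [hp, Polynomial.eval_prod]
    exact Finset.prod_eq_zero (mem_univ k) (by simp)
  have hmono : StrictMonoOn (fun t => p.eval t) (Set.Ici 0) :=
    strictMonoOn_of_deriv_pos (convex_Ici 0) p.continuous.continuousOn fun t ht => by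
      rw [Polynomial.deriv]
      exact hd t (by simpa using (interior_subset ht))
  have heq : -lam i = -lam j := hmono.injOn (by simpa using hi) (by simpa using hj)
    (by simp only [hroot])
  have h0 : p.derivative.eval (-lam i) = 0 := by
    rw [hp, Polynomial.derivative_prod_finset, Polynomial.eval_finsetSum]
    refine Finset.sum_eq_zero fun k _ => ?_
    rw [Polynomial.eval_mul, Polynomial.eval_prod]
    by_cases hk : k = i
    · rw [Finset.prod_eq_zero (i := j) (by simp [hk, hij.symm]) (by simp [heq]), zero_mul]
    · rw [Finset.prod_eq_zero (i := i) (by simp [Ne.symm hk]) (by simp), zero_mul]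
  exact (hd (-lam i) (by linarith)).ne' h0

end GammaTilde

/-- `φ` is twice differentiable at `0`, with first and second derivatives `a` and `b` there. -/
def HasTwoJet (φ : ℝ → ℝ) (a b : ℝ) : Prop :=
  ∃ φ' : ℝ → ℝ, (∀ᶠ t in 𝓝 0, HasDerivAt φ (φ' t) t) ∧ φ' 0 = a ∧ HasDerivAt φ' b 0

namespace HasTwoJet

variable {φ ψ : ℝ → ℝ} {a b a' b' : ℝ}

lemma continuousAt (h : HasTwoJet φ a b) : ContinuousAt φ 0 := by
  obtain ⟨φ', h1, -, -⟩ := h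
  exact h1.self_of_nhds.continuousAt

lemma unique (h : HasTwoJet φ a b) (h' : HasTwoJet ψ a' b') (he : φ =ᶠ[𝓝 0] ψ) :
    a = a' ∧ b = b' := by
  obtain ⟨φ', h1, rfl, h3⟩ := h
  obtain ⟨ψ', k1, rfl, k3⟩ := h'
  have e : φ' =ᶠ[𝓝 0] ψ' := by
    filter_upwards [h1, k1, he.eventually_nhds] with t ht1 ht2 ht3
    exact ht1.unique (ht2.congr_of_eventuallyEq ht3)
  exact ⟨e.self_of_nhds, h3.unique (k3.congr_of_eventuallyEq e)⟩

lemma const (c : ℝ) : HasTwoJet (fun _ => c) 0 0 :=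
  ⟨fun _ => 0, Filter.Eventually.of_forall fun t => hasDerivAt_const t c, rfl,
    hasDerivAt_const 0 0⟩

lemma id' : HasTwoJet (fun t => t) 1 0 :=
  ⟨fun _ => 1, Filter.Eventually.of_forall fun t => hasDerivAt_id t, rfl, hasDerivAt_const 0 1⟩

lemma add (h : HasTwoJet φ a b) (h' : HasTwoJet ψ a' b') :
    HasTwoJet (fun t => φ t + ψ t) (a + a') (b + b') := by
  obtain ⟨φ', h1, rfl, h3⟩ := h
  obtain ⟨ψ', k1, rfl, k3⟩ := h'
  exact ⟨fun t => φ' t + ψ' t, by filter_upwards [h1, k1] with t x y using x.fun_add y, rfl,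
    h3.fun_add k3⟩

lemma mul (h : HasTwoJet φ a b) (h' : HasTwoJet ψ a' b') :
    HasTwoJet (fun t => φ t * ψ t) (a * ψ 0 + φ 0 * a')
      (b * ψ 0 + 2 * (a * a') + φ 0 * b') := by
  obtain ⟨φ', h1, rfl, h3⟩ := h
  obtain ⟨ψ', k1, rfl, k3⟩ := h'
  refine ⟨fun t => φ' t * ψ t + φ t * ψ' t,
    by filter_upwards [h1, k1] with t x y using x.fun_mul y, rfl, ?_⟩
  refine ((h3.fun_mul k1.self_of_nhds).fun_add (h1.self_of_nhds.fun_mul k3)).congr_deriv ?_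
  ring

lemma const_mul (c : ℝ) (h : HasTwoJet φ a b) : HasTwoJet (fun t => c * φ t) (c * a) (c * b) := by
  obtain ⟨φ', h1, rfl, h3⟩ := h
  exact ⟨fun t => c * φ' t, by filter_upwards [h1] with t x using x.const_mul c, rfl,
    h3.const_mul c⟩

lemma sum {ι : Type*} {s : Finset ι} {φ : ι → ℝ → ℝ} {a b : ι → ℝ}
    (h : ∀ i ∈ s, HasTwoJet (φ i) (a i) (b i)) :
    HasTwoJet (fun t => ∑ i ∈ s, φ i t) (∑ i ∈ s, a i) (∑ i ∈ s, b i) := by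
  classical
  induction s using Finset.induction_on with
  | empty => simpa using const 0
  | insert k s hk ih =>
    simp only [Finset.sum_insert hk]
    exact (h k (mem_insert_self k s)).add (ih fun i hi => h i (mem_insert_of_mem hi))

lemma log (h : HasTwoJet φ a b) (h0 : φ 0 ≠ 0) :
    HasTwoJet (fun t => Real.log (φ t)) (a / φ 0) (b / φ 0 - a ^ 2 / φ 0 ^ 2) := by
  have hne : ∀ᶠ t in 𝓝 0, φ t ≠ 0 := h.continuousAt.eventually_ne h0
  obtain ⟨φ', h1, rfl, h3⟩ := h
  refine ⟨fun t => φ' t / φ t, by filter_upwards [h1, hne] with t x y using x.log y, rfl, ?_⟩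
  refine (h3.fun_div h1.self_of_nhds h0).congr_deriv ?_
  field_simp

lemma of_isLocalMax (h : HasTwoJet φ a b) (hmax : IsLocalMax φ 0) : a = 0 ∧ b ≤ 0 := by
  obtain ⟨φ', h1, rfl, h3⟩ := h
  have ha : φ' 0 = 0 := hmax.hasDerivAt_eq_zero h1.self_of_nhds
  refine ⟨ha, ?_⟩
  by_contra! hb
  have e : deriv φ =ᶠ[𝓝 0] φ' := by filter_upwards [h1] with t x using x.deriv
  have hd : deriv (deriv φ) 0 = b := by rw [e.deriv_eq]; exact h3.deriv
  have hmin : IsLocalMin φ 0 := isLocalMin_of_deriv_deriv_pos (by rw [hd]; exact hb)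
    (by rw [e.self_of_nhds]; exact ha) h1.self_of_nhds.continuousAt
  have hc : φ =ᶠ[𝓝 0] fun _ => φ 0 := by
    filter_upwards [hmax, hmin] with t x y using le_antisymm x y
  have := (unique ⟨φ', h1, rfl, h3⟩ (const (φ 0)) hc).2
  linarith

end HasTwoJet

section Det

variable {ι : Type*} [Fintype ι] [DecidableEq ι]

lemma hasDerivAt_det {H : ℝ → Matrix ι ι ℝ} {H' : Matrix ι ι ℝ} {t : ℝ}
    (h : ∀ i j, HasDerivAt (fun t => H t i j) (H' i j) t) :
    HasDerivAt (fun t => (H t).det) (∑ p, ((H t).updateRow p (H' p)).det) t := by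
  have h1 : HasDerivAt (fun t => (H t).det) (∑ σ : Equiv.Perm ι, (Equiv.Perm.sign σ : ℤ) *
      ∑ p, (∏ i ∈ univ.erase p, H t i (σ i)) • H' p (σ p)) t := by
    have e : (fun t => (H t).det) = fun t => ∑ σ : Equiv.Perm ι, (Equiv.Perm.sign σ : ℤ) *
        ∏ i, H t i (σ i) := by
      funext t
      rw [← Matrix.det_transpose, Matrix.det_apply']
      rfl
    rw [e]
    exact HasDerivAt.fun_sum fun σ _ => (HasDerivAt.fun_finsetProd fun i _ => h i (σ i)).const_mul _
  refine h1.congr_deriv ?_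
  simp_rw [Finset.mul_sum]
  rw [Finset.sum_comm]
  refine Finset.sum_congr rfl fun p _ => ?_
  rw [← Matrix.det_transpose, Matrix.det_apply']
  refine Finset.sum_congr rfl fun σ _ => ?_
  simp only [Matrix.transpose_apply]
  rw [← Finset.mul_prod_erase univ _ (mem_univ p), Matrix.updateRow_self, smul_eq_mul,
    mul_comm (∏ i ∈ _, _)]
  congr 2
  exact Finset.prod_congr rfl fun i hi => by rw [Matrix.updateRow_ne (ne_of_mem_erase hi)]

lemma det_updateRow_diagonal (d x : ι → ℝ) (p : ι) :
    ((Matrix.diagonal d).updateRow p x).det = x p * ∏ i ∈ univ.erase p, d i := by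
  rw [← Matrix.cramer_transpose_apply, Matrix.diagonal_transpose, Matrix.cramer_eq_adjugate_mulVec,
    Matrix.adjugate_diagonal, Matrix.mulVec_diagonal, mul_comm]

lemma det_updateRow_updateRow_diagonal (d x y : ι → ℝ) {p q : ι} (hpq : q ≠ p) :
    (((Matrix.diagonal d).updateRow p x).updateRow q y).det =
      (x p * y q - x q * y p) * ∏ i ∈ (univ.erase p).erase q, d i := by
  let e : ι → ℝ := Function.update (Function.update d p 1) q 1
  let V : Matrix (Fin 2) ι ℝ := Matrix.of ![x - Pi.single p 1, y - Pi.single q 1]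
  let W : Matrix ι (Fin 2) ℝ :=
    Matrix.of fun i => ![(Pi.single p 1 : ι → ℝ) i, (Pi.single q 1 : ι → ℝ) i]
  have h1 : ((Matrix.diagonal d).updateRow p x).updateRow q y =
      Matrix.diagonal e * (1 + W * V) := by
    ext i j
    rw [Matrix.diagonal_mul, Matrix.add_apply, Matrix.mul_apply]
    simp only [Fin.sum_univ_two, V, W, e, Matrix.of_apply]
    by_cases hq : i = q
    · subst hq; simp [hpq, Matrix.one_apply, Pi.single_apply, eq_comm]
    · by_cases hp : i = p
      · subst hp; simp [hq, Matrix.one_apply, Pi.single_apply, eq_comm]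
      · simp [hq, hp, Matrix.one_apply, Matrix.diagonal_apply]
  have h2 : ∏ i, e i = ∏ i ∈ (univ.erase p).erase q, d i := by
    rw [← Finset.mul_prod_erase univ _ (mem_univ p),
      ← Finset.mul_prod_erase (univ.erase p) _ (mem_erase.2 ⟨hpq, mem_univ q⟩)]
    simp only [e, Function.update_self, one_mul, Function.update_of_ne hpq.symm]
    refine Finset.prod_congr rfl fun i hi => ?_
    rw [Function.update_of_ne (ne_of_mem_erase hi),
      Function.update_of_ne (ne_of_mem_erase (mem_of_mem_erase hi))]
  rw [h1, Matrix.det_mul, Matrix.det_diagonal, h2, Matrix.det_one_add_mul_comm, Matrix.det_fin_two]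
  have h3 : ∀ (z : ι → ℝ) (r : Fin 2), Matrix.vecMul z W r = ![z p, z q] r := by
    intro z r
    fin_cases r <;> simp [Matrix.vecMul, dotProduct, W, Pi.single_apply]
  simp [V, h3, hpq, hpq.symm]
  ring

/-- Two-jet of a determinant along a curve of matrices starting at a diagonal matrix. -/
lemma hasTwoJet_det {H : ℝ → Matrix ι ι ℝ} {d : ι → ℝ} {H₁ H₂ : Matrix ι ι ℝ}
    (h : ∀ i j, HasTwoJet (fun t => H t i j) (H₁ i j) (H₂ i j)) (h0 : H 0 = Matrix.diagonal d) :
    HasTwoJet (fun t => (H t).det) (∑ p, (∏ i ∈ univ.erase p, d i) * H₁ p p)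
      (∑ p, (∏ i ∈ univ.erase p, d i) * H₂ p p + ∑ p, ∑ q ∈ univ.erase p,
        (∏ i ∈ (univ.erase p).erase q, d i) * (H₁ p p * H₁ q q - H₁ p q * H₁ q p)) := by
  choose H' h1 h2 h3 using h
  refine ⟨fun t => ∑ p, ((H t).updateRow p fun j => H' p j t).det, ?_, ?_, ?_⟩
  · have := Filter.eventually_all.2 fun i => Filter.eventually_all.2 fun j => h1 i j
    filter_upwards [this] with t ht
    exact hasDerivAt_det (H' := Matrix.of fun i j => H' i j t) ht
  · simp only [h0, det_updateRow_diagonal, h2, mul_comm]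
  · rw [← Finset.sum_add_distrib]
    refine HasDerivAt.fun_sum fun p _ => ?_
    have h4 : ∀ i j, HasDerivAt (fun t => ((H t).updateRow p fun j => H' p j t) i j)
        ((H₁.updateRow p (H₂ p)) i j) 0 := by
      intro i j
      by_cases hi : i = p
      · subst hi; simpa using h3 i j
      · simp only [Matrix.updateRow_ne hi]
        rw [← h2]
        exact (h1 i j).self_of_nhds
    refine (hasDerivAt_det h4).congr_deriv ?_
    rw [← Finset.add_sum_erase univ _ (mem_univ p)]
    congr 1
    · rw [Matrix.updateRow_idem, Matrix.updateRow_self, h0, det_updateRow_diagonal, mul_comm]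
    · refine Finset.sum_congr rfl fun q hq => ?_
      have hq' := ne_of_mem_erase hq
      rw [Matrix.updateRow_ne hq', h0, det_updateRow_updateRow_diagonal _ _ _ hq']
      simp only [h2]
      ring

end Det

/-- Two-jet of the sum Hessian operator along a curve of matrices starting at a diagonal matrix. -/
lemma hasTwoJet_sum_det {n : ℕ} {α : ℝ} {d s : Fin (n + 1) → ℝ}
    (hds : ∀ (lam : Fin n → ℝ) (A : Finset (Fin n)),
      sumSym α lam A = ∑ k, d k * ∏ i ∈ A, (lam i + s k))
    {H : ℝ → Matrix (Fin n) (Fin n) ℝ} {lam : Fin n → ℝ} {H₁ H₂ : Matrix (Fin n) (Fin n) ℝ}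
    (h : ∀ i j, HasTwoJet (fun t => H t i j) (H₁ i j) (H₂ i j))
    (h0 : H 0 = Matrix.diagonal lam) :
    HasTwoJet (fun t => ∑ k, d k * (H t + Matrix.diagonal fun _ => s k).det)
      (∑ p, sumSym α lam (univ.erase p) * H₁ p p)
      (∑ p, sumSym α lam (univ.erase p) * H₂ p p + ∑ p, ∑ q ∈ univ.erase p,
        sumSym α lam ((univ.erase p).erase q) * (H₁ p p * H₁ q q - H₁ p q * H₁ q p)) := by
  have key := HasTwoJet.sum (s := univ) fun k (_ : k ∈ univ) => HasTwoJet.const_mul (d k)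
    (hasTwoJet_det (H := fun t => H t + Matrix.diagonal fun _ => s k) (d := fun i => lam i + s k)
      (H₁ := H₁) (H₂ := H₂) (fun i j => by
        simpa using (h i j).add (HasTwoJet.const (Matrix.diagonal (fun _ => s k) i j)))
      (by rw [h0, Matrix.diagonal_add]))
  convert key using 1
  · simp only [hds, Finset.sum_mul, Finset.mul_sum]
    rw [Finset.sum_comm]
    simp only [mul_assoc]
  · simp only [hds, Finset.sum_mul, Finset.mul_sum, mul_add, Finset.sum_add_distrib]
    congr 1
    · rw [Finset.sum_comm]
      simp only [mul_assoc]
    · rw [Finset.sum_comm]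
      refine Finset.sum_congr rfl fun p _ => ?_
      rw [Finset.sum_comm]
      simp only [mul_assoc]

section PointEstimate

variable {n : ℕ} {α m K : ℝ} {lam : Fin n → ℝ} {o : Fin n} {W : Fin n → Fin n → ℝ}

lemma sumSym_erase_eq_add {ι : Type*} [DecidableEq ι] {lam : ι → ℝ} {A : Finset ι} {p q : ι}
    (hp : p ∈ A) (hq : q ∈ A) (hpq : q ≠ p) :
    sumSym α lam (A.erase q) =
      sumSym α lam (A.erase p) + (lam p - lam q) * sumSym α lam ((A.erase p).erase q) := by
  rw [sumSym_eq_erase (A := A.erase q) (i := p) (mem_erase.2 ⟨hpq.symm, hp⟩),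
    sumSym_eq_erase (A := A.erase p) (i := q) (mem_erase.2 ⟨hpq, hq⟩), erase_right_comm]
  ring

lemma neg_one_lt_mul_of_sumSym_pos (hS : ∀ A, 0 < sumSym α lam A) (q : Fin n) :
    -1 < α * lam q := by
  have := hS {q}
  simp only [sumSym, sum_singleton, prod_singleton, erase_singleton, prod_empty] at this
  linarith

lemma le_two_mul_mul_sumSym_erase (hα : 0 < α) (hpos : ∀ i j, i ≠ j → lam i ≤ 0 → 0 < lam j)
    (hg : 1 ≤ α * lam o) (hS : ∀ A, 0 < sumSym α lam A) :
    sumSym α lam univ ≤ 2 * (lam o * sumSym α lam (univ.erase o)) := by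
  have hgpos : 0 < lam o := pos_of_mul_pos_right (by linarith) hα.le
  have h1 := sumSym_eq_erase (α := α) (lam := lam) (mem_univ o)
  have h2 := mul_pos hgpos (hS (univ.erase o))
  by_cases hall : ∀ i ∈ univ.erase o, 0 < lam i
  · have h3 : 0 ≤ ∑ i ∈ univ.erase o, ∏ j ∈ (univ.erase o).erase i, lam j :=
      Finset.sum_nonneg fun i _ => (Finset.prod_pos fun j hj => hall j (mem_of_mem_erase hj)).le
    have h4 : 0 < ∏ j ∈ univ.erase o, lam j := Finset.prod_pos hall
    have h5 : α * ∏ j ∈ univ.erase o, lam j ≤ sumSym α lam (univ.erase o) := by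
      rw [sumSym]; linarith
    have h6 := mul_le_mul_of_nonneg_left h5 hgpos.le
    nlinarith
  · push Not at hall
    obtain ⟨l, hl, hl0⟩ := hall
    have h3 : ∏ j ∈ univ.erase o, lam j ≤ 0 := by
      rw [← Finset.mul_prod_erase _ _ hl]
      exact mul_nonpos_of_nonpos_of_nonneg hl0 (Finset.prod_nonneg fun i hi =>
        (hpos l i (ne_of_mem_erase hi).symm hl0).le)
    linarith

lemma sum_sumSym_erase_mul_le {lam : Fin n → ℝ} (h : 0 ≤ ∑ i, ∏ j ∈ univ.erase i, lam j) :
    ∑ i, sumSym α lam (univ.erase i) * lam i ≤ n * sumSym α lam univ := by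
  have : ∀ i ∈ univ, sumSym α lam (univ.erase i) * lam i =
      sumSym α lam univ - ∏ j ∈ univ.erase i, lam j := fun i hi => by
    rw [sumSym_eq_erase hi]; ring
  rw [Finset.sum_congr rfl this, Finset.sum_sub_distrib]
  simp only [sum_const, card_univ, Fintype.card_fin, nsmul_eq_mul]
  linarith

/-- The third order terms are nonnegative up to the gradient of the right-hand side, with a
surplus controlling the third derivatives `W o q`, `q ≠ o`. -/
lemma third_order_estimate (hα : 0 < α) (hm : 0 < m)
    (hpos : ∀ i j, i ≠ j → lam i ≤ 0 → 0 < lam j) (hS : ∀ A, 0 < sumSym α lam A)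
    (hSm : m ≤ sumSym α lam univ) (hg : 4 ≤ α * lam o) (hK : 2 * (1 + 2 * n) ≤ K * m)
    (hW : ∀ p q, W p q = W q p) :
    1 / 2 * ∑ q ∈ univ.erase o, sumSym α lam (univ.erase q) * W o q ^ 2 -
      K * lam o * (∑ p, sumSym α lam (univ.erase p) * W p p) ^ 2 ≤
    -(lam o * ∑ p, ∑ q ∈ univ.erase p,
        sumSym α lam ((univ.erase p).erase q) * (W p p * W q q - W p q * W q p)) +
      ∑ i, sumSym α lam (univ.erase i) *
        ∑ q ∈ univ.erase o, (2 + 2 * lam q / lam o) * W i q ^ 2 -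
      ∑ i, sumSym α lam (univ.erase i) * W o i ^ 2 := by
  have hform := thirdForm_nonneg (K := K) hα hm (mem_univ o) hpos hSm (by linarith)
    (by simpa using hK) fun p => W p p
  rw [thirdForm] at hform
  have hgpos : 0 < lam o := pos_of_mul_pos_right (by linarith) hα.le
  have hr : ∀ q, -(1 / 4) ≤ lam q / lam o := fun q => by
    rw [le_div_iff₀ hgpos]
    have := neg_one_lt_mul_of_sumSym_pos hS q
    nlinarith
  have e1 : ∑ p, ∑ q ∈ univ.erase p,
        sumSym α lam ((univ.erase p).erase q) * (W p p * W q q - W p q * W q p) =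
      ∑ p, ∑ q ∈ univ.erase p, sumSym α lam ((univ.erase p).erase q) * (W p p * W q q) -
      ∑ p, ∑ q ∈ univ.erase p, sumSym α lam ((univ.erase p).erase q) * W p q ^ 2 := by
    rw [← Finset.sum_sub_distrib]
    refine Finset.sum_congr rfl fun p _ => ?_
    rw [← Finset.sum_sub_distrib]
    refine Finset.sum_congr rfl fun q _ => ?_
    rw [hW q p]; ring
  have h1 : 2 * ∑ q ∈ univ.erase o, sumSym α lam ((univ.erase o).erase q) * W o q ^ 2 ≤
      ∑ p, ∑ q ∈ univ.erase p, sumSym α lam ((univ.erase p).erase q) * W p q ^ 2 := by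
    rw [← Finset.add_sum_erase univ _ (mem_univ o), two_mul]
    refine add_le_add_right (Finset.sum_le_sum fun p hp => ?_) _
    have hpo : o ∈ univ.erase p := mem_erase.2 ⟨(ne_of_mem_erase hp).symm, mem_univ o⟩
    refine le_trans (le_of_eq ?_) (Finset.single_le_sum (fun q _ => ?_) hpo)
    · rw [hW p o, erase_right_comm]
    · exact mul_nonneg (hS _).le (sq_nonneg _)
  have h2 : ∑ q ∈ univ.erase o, (sumSym α lam (univ.erase o) * ((2 + 2 * lam q / lam o) * W o q ^ 2)
        + 3 / 2 * (sumSym α lam (univ.erase q) * W q q ^ 2)) ≤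
      ∑ i, sumSym α lam (univ.erase i) *
        ∑ q ∈ univ.erase o, (2 + 2 * lam q / lam o) * W i q ^ 2 := by
    simp_rw [Finset.mul_sum]
    rw [Finset.sum_comm]
    refine Finset.sum_le_sum fun q hq => ?_
    have hc : 3 / 2 ≤ 2 + 2 * lam q / lam o := by
      have := hr q
      rw [mul_div_assoc]; linarith
    have hnn : ∀ i ∈ univ.erase o, 0 ≤ sumSym α lam (univ.erase i) *
        ((2 + 2 * lam q / lam o) * W i q ^ 2) := fun i _ =>
      mul_nonneg (hS _).le (mul_nonneg (by linarith) (sq_nonneg _))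
    rw [← Finset.add_sum_erase univ _ (mem_univ o)]
    refine add_le_add_right ((le_of_eq_of_le ?_ (mul_le_mul_of_nonneg_right hc
      (mul_nonneg (hS (univ.erase q)).le (sq_nonneg (W q q))))).trans
      (le_of_eq_of_le ?_ (Finset.single_le_sum hnn hq))) _ <;> ring
  have h3 : 0 ≤ ∑ q ∈ univ.erase o, (2 * lam o * (sumSym α lam ((univ.erase o).erase q) * W o q ^ 2)
        + sumSym α lam (univ.erase o) * ((2 + 2 * lam q / lam o) * W o q ^ 2)
        - 3 / 2 * (sumSym α lam (univ.erase q) * W o q ^ 2)) := by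
    refine Finset.sum_nonneg fun q hq => ?_
    rw [sumSym_erase_eq_add (mem_univ o) (mem_univ q) (ne_of_mem_erase hq)]
    have e : lam q = lam o * (lam q / lam o) := by field_simp
    have hrq := hr q
    rw [mul_div_assoc]
    have a1 : 0 ≤ sumSym α lam (univ.erase o) * (1 / 2 + 2 * (lam q / lam o)) :=
      mul_nonneg (hS _).le (by linarith)
    have a2 : 0 ≤ sumSym α lam ((univ.erase o).erase q) * (lam o / 2 + 3 / 2 * lam q) :=
      mul_nonneg (hS _).le (by rw [e]; nlinarith)
    have := mul_nonneg (add_nonneg a1 a2) (sq_nonneg (W o q))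
    linarith
  simp only [Finset.sum_add_distrib, Finset.sum_sub_distrib, ← Finset.mul_sum] at h2 h3
  have e2 := Finset.add_sum_erase univ (fun i => sumSym α lam (univ.erase i) * W o i ^ 2)
    (mem_univ o)
  rw [e1, ← e2]
  have h4 := mul_le_mul_of_nonneg_left h1 hgpos.le
  linarith

/-- The gradient terms of the cut-off factor are absorbed by the third order surplus and the
quadratic terms in the eigenvalues. -/
lemma gradient_terms_estimate {β a v M : ℝ} {S w : Fin n → ℝ} (hS : ∀ i, 0 < S i) (hv : 0 < v)
    (ha : 0 < a) (hβ : 4 ≤ β) (hβa : 4 * a * M ^ 2 ≤ β) (hw : ∀ i, |w i| ≤ M)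
    (hcrit : ∀ i, W o i / lam o = β * w i / v - a * w i * lam i)
    (hbig : 4 * β * M ^ 2 ≤ a * (lam o * v) ^ 2) :
    ∑ i, S i * (β * (w i ^ 2 / v ^ 2)) ≤
      1 / 2 * ∑ q ∈ univ.erase o, S q * (W o q / lam o) ^ 2 +
        1 / 2 * a * ∑ q ∈ univ.erase o, S q * lam q ^ 2 + 1 / 4 * a * (S o * lam o ^ 2) := by
  have hw2 : ∀ i, w i ^ 2 ≤ M ^ 2 := fun i => sq_le_sq' (abs_le.1 (hw i)).1 (abs_le.1 (hw i)).2
  have hβ0 : 0 < β := by linarith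
  have h1 : ∀ q ∈ univ.erase o, S q * (β * (w q ^ 2 / v ^ 2)) ≤
      1 / 2 * (S q * (W o q / lam o) ^ 2) + 1 / 2 * a * (S q * lam q ^ 2) := by
    intro q _
    have e : β * (w q / v) = W o q / lam o + a * w q * lam q := by rw [hcrit q]; ring
    rw [← div_pow]
    have h2 : β * (β * (w q / v) ^ 2) ≤
        β * (1 / 2 * (W o q / lam o) ^ 2 + 1 / 2 * a * lam q ^ 2) := by
      have h3 : β * (β * (w q / v) ^ 2) = (W o q / lam o + a * w q * lam q) ^ 2 := by
        rw [← e]; ring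
      have h4 : (a * w q * lam q) ^ 2 ≤ a ^ 2 * M ^ 2 * lam q ^ 2 := by
        rw [mul_pow, mul_pow]
        exact mul_le_mul_of_nonneg_right (mul_le_mul_of_nonneg_left (hw2 q) (sq_nonneg a))
          (sq_nonneg _)
      have h5 := mul_le_mul_of_nonneg_right hβa (by positivity : 0 ≤ 1 / 2 * a * lam q ^ 2)
      have h6 := mul_le_mul_of_nonneg_right hβ (by positivity : 0 ≤ 1 / 2 * (W o q / lam o) ^ 2)
      rw [h3]
      linarith [sq_nonneg (W o q / lam o - a * w q * lam q)]
    have h3 := mul_le_mul_of_nonneg_left (le_of_mul_le_mul_left h2 hβ0) (hS q).le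
    linarith
  have h2 : S o * (β * (w o ^ 2 / v ^ 2)) ≤ 1 / 4 * a * (S o * lam o ^ 2) := by
    have h3 : β * (w o ^ 2 / v ^ 2) ≤ 1 / 4 * a * lam o ^ 2 := by
      rw [← mul_div_assoc, div_le_iff₀ (by positivity)]
      have := mul_le_mul_of_nonneg_left (hw2 o) hβ0.le
      linarith
    have := mul_le_mul_of_nonneg_left h3 (hS o).le
    linarith
  rw [← Finset.add_sum_erase univ _ (mem_univ o)]
  have h3 := Finset.sum_le_sum h1
  rw [Finset.sum_add_distrib, ← Finset.mul_sum, ← Finset.mul_sum] at h3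
  linarith

lemma neg_mul_le_mul_of_abs_le {x y c d : ℝ} (hx : |x| ≤ c) (hy : |y| ≤ d) :
    -(c * d) ≤ x * y := by
  have h1 : |x * y| ≤ c * d := by
    rw [abs_mul]; exact mul_le_mul hx hy (abs_nonneg _) ((abs_nonneg _).trans hx)
  linarith [neg_abs_le (x * y)]

/-- Adding up the second order condition, the third order estimate and the gradient estimate. -/
lemma sum_estimates {b a g A G V T P R E Q Q₀ X p y z q k B N N' N'' c : ℝ}
    (hsum : -(b * A) - G + V + P - R + a * (Q₀ + Q) + a * X ≤ 0)
    (hthird : 1 / 2 * E - k ≤ -T + P - R)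
    (hgrad : G ≤ 1 / 2 * E + 1 / 2 * a * Q + 1 / 4 * a * Q₀)
    (hVT : V + T = q + p) (hcancel : p + a * X = b * y + a * z)
    (hA : b * A ≤ b * N) (hy : b * -N' ≤ b * y) (hz : a * -N'' ≤ a * z)
    (hq : -(c * g) ≤ q) (hk : k ≤ (B - c) * g) (hQ : 0 ≤ a * Q)
    (hQ₀ : 32 * (B * g) ≤ 2 * (a * Q₀)) (hN'' : a * (16 * N'') ≤ 32 * (B * g)) (hBg : 0 ≤ B * g) :
    B * g ≤ b * (N + N') := by
  linarith

/-- The conclusion of the maximum principle at an interior maximum point, from the first and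
second order conditions `hcrit`, `hconc` and the differentiated equation. -/
lemma point_estimate {β a v M F B C₁ q₀ : ℝ} {w φ ℓ V X : Fin n → ℝ} (hα : 0 < α) (hm : 0 < m)
    (hM : 0 < M) (hF : 0 < F) (hv : 0 < v) (ha : 0 < a) (hβ : 4 ≤ β) (hβa : 4 * a * M ^ 2 ≤ β)
    (hpos : ∀ i j, i ≠ j → lam i ≤ 0 → 0 < lam j) (hS : ∀ A, 0 < sumSym α lam A)
    (hSm : m ≤ sumSym α lam univ) (hSF : sumSym α lam univ ≤ F)
    (hσ : 0 ≤ ∑ i, ∏ j ∈ univ.erase i, lam j)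
    (hw : ∀ i, |w i| ≤ M) (hφ : ∀ i, |φ i| ≤ F) (hℓ : ∀ i, |ℓ i| ≤ F * (1 + M))
    (hW : ∀ p q, W p q = W q p)
    (hX : ∑ i, sumSym α lam (univ.erase i) * X i = ∑ k, w k * (ℓ k + lam k * φ k))
    (hE : ∑ p, sumSym α lam (univ.erase p) * W p p = ℓ o + lam o * φ o)
    (hE' : ∑ p, sumSym α lam (univ.erase p) * V p + ∑ p, ∑ q ∈ univ.erase p,
        sumSym α lam ((univ.erase p).erase q) * (W p p * W q q - W p q * W q p) =
      q₀ + ∑ k, φ k * W o k)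
    (hq₀ : -(C₁ * (1 + lam o) ^ 2) ≤ q₀) (hC₁ : 0 ≤ C₁)
    (hcrit : ∀ i, W o i / lam o = β * w i / v - a * w i * lam i)
    (hconc : ∀ i, β * (-lam i / v - w i ^ 2 / v ^ 2) + (V i / lam o +
        ∑ q ∈ univ.erase o, (2 + 2 * lam q / lam o) * W i q ^ 2 / lam o ^ 2) -
        W o i ^ 2 / lam o ^ 2 + a * (lam i ^ 2 + X i) ≤ 0)
    (hK : 2 * (1 + 2 * n) ≤ K * m) (hK0 : 0 < K)
    (hB : B = 4 * C₁ + K * F ^ 2 * (2 + M) ^ 2) (haB : a * m = 32 * B)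
    (hg1 : 1 ≤ lam o) (hg : 4 ≤ α * lam o) (hgm : 16 * (n * M * F * (1 + M)) ≤ m * lam o)
    (hbig : 4 * β * M ^ 2 ≤ a * (lam o * v) ^ 2) :
    B * (lam o * v) ≤ β * (n * F * (1 + M)) := by
  have hgpos : 0 < lam o := by linarith
  have hβ0 : 0 < β := by linarith
  have hthird := third_order_estimate (K := K) hα hm hpos hS hSm hg hK hW
  have hgrad := gradient_terms_estimate (S := fun i => sumSym α lam (univ.erase i))
    (fun i => hS _) hv ha hβ hβa hw hcrit hbig
  have hSo := le_two_mul_mul_sumSym_erase hα hpos (by linarith) hS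
  have hSl : ∑ i, sumSym α lam (univ.erase i) * lam i ≤ n * F :=
    (sum_sumSym_erase_mul_le hσ).trans (mul_le_mul_of_nonneg_left hSF n.cast_nonneg)
  have hsum := Finset.sum_nonpos fun i (_ : i ∈ univ) =>
    mul_nonpos_of_nonneg_of_nonpos (hS (univ.erase i)).le (hconc i)
  set S : Fin n → ℝ := fun i => sumSym α lam (univ.erase i) with hSdef
  set T := ∑ p, ∑ q ∈ univ.erase p,
    sumSym α lam ((univ.erase p).erase q) * (W p p * W q q - W p q * W q p) with hT
  have hsplit : ∑ i, S i * (β * (-lam i / v - w i ^ 2 / v ^ 2) + (V i / lam o +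
        ∑ q ∈ univ.erase o, (2 + 2 * lam q / lam o) * W i q ^ 2 / lam o ^ 2) -
        W o i ^ 2 / lam o ^ 2 + a * (lam i ^ 2 + X i)) =
      -(β / v * ∑ i, S i * lam i) - ∑ i, S i * (β * (w i ^ 2 / v ^ 2)) +
      (∑ i, S i * V i) / lam o +
      (∑ i, S i * ∑ q ∈ univ.erase o, (2 + 2 * lam q / lam o) * W i q ^ 2) / lam o ^ 2 -
      (∑ i, S i * W o i ^ 2) / lam o ^ 2 + a * ∑ i, S i * lam i ^ 2 + a * ∑ i, S i * X i := by
    simp only [Finset.mul_sum, Finset.sum_div, ← Finset.sum_neg_distrib, ← Finset.sum_sub_distrib,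
      ← Finset.sum_add_distrib]
    refine Finset.sum_congr rfl fun i _ => ?_
    simp only [mul_add, mul_sub, Finset.mul_sum, mul_div_assoc]
    ring
  rw [hsplit] at hsum
  have hthird' : 1 / 2 * ∑ q ∈ univ.erase o, S q * (W o q / lam o) ^ 2 -
      K * (ℓ o + lam o * φ o) ^ 2 / lam o ≤ -(T / lam o) +
      (∑ i, S i * ∑ q ∈ univ.erase o, (2 + 2 * lam q / lam o) * W i q ^ 2) / lam o ^ 2 -
      (∑ i, S i * W o i ^ 2) / lam o ^ 2 := by
    rw [hE] at hthird
    have h1 := div_le_div_of_nonneg_right hthird (by positivity : 0 ≤ lam o ^ 2)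
    refine le_of_eq_of_le ?_ (h1.trans_eq ?_)
    · rw [sub_div, mul_div_assoc (1 / 2), Finset.sum_div]
      congr 1
      · congr 1
        exact Finset.sum_congr rfl fun q _ => by rw [div_pow, mul_div_assoc]
      · field_simp
    · rw [sub_div, add_div]
      congr 2
      field_simp
  have hVT : (∑ i, S i * V i) / lam o + T / lam o = q₀ / lam o + (∑ k, φ k * W o k) / lam o := by
    rw [← add_div, ← add_div, ← hE']
  have hcancel : (∑ k, φ k * W o k) / lam o + a * ∑ i, S i * X i =
      β / v * ∑ k, φ k * w k + a * ∑ k, w k * ℓ k := by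
    rw [hX, Finset.sum_div]
    simp only [Finset.mul_sum, ← Finset.sum_add_distrib]
    refine Finset.sum_congr rfl fun k _ => ?_
    rw [mul_div_assoc, hcrit k]
    ring
  have hφw : -(n * (F * M)) ≤ ∑ k, φ k * w k := by
    have := Finset.sum_le_sum fun k (_ : k ∈ univ) => neg_mul_le_mul_of_abs_le (hφ k) (hw k)
    simpa using this
  have hwℓ : -(n * (M * (F * (1 + M)))) ≤ ∑ k, w k * ℓ k := by
    have := Finset.sum_le_sum fun k (_ : k ∈ univ) => neg_mul_le_mul_of_abs_le (hw k) (hℓ k)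
    simpa using this
  have hq₀' : -(4 * C₁ * lam o) ≤ q₀ / lam o := by
    rw [le_div_iff₀ hgpos]
    have h1 : (1 + lam o) ^ 2 ≤ 4 * lam o ^ 2 := by nlinarith only [hg1]
    have := mul_le_mul_of_nonneg_left h1 hC₁
    linarith only [this, hq₀]
  have hK' : K * (ℓ o + lam o * φ o) ^ 2 / lam o ≤ K * F ^ 2 * (2 + M) ^ 2 * lam o := by
    rw [div_le_iff₀ hgpos]
    have h1 : |ℓ o + lam o * φ o| ≤ F * (2 + M) * lam o := by
      refine (abs_add_le _ _).trans ?_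
      rw [abs_mul, abs_of_pos hgpos]
      have h2 := mul_le_mul_of_nonneg_left (hφ o) hgpos.le
      have h3 := hℓ o
      have h4 : F * (1 + M) ≤ F * (1 + M) * lam o := le_mul_of_one_le_right (by positivity) hg1
      linarith only [h2, h3, h4]
    have h2 : (ℓ o + lam o * φ o) ^ 2 ≤ (F * (2 + M) * lam o) ^ 2 :=
      sq_le_sq' (abs_le.1 h1).1 (abs_le.1 h1).2
    have := mul_le_mul_of_nonneg_left h2 hK0.le
    linarith only [this]
  have hquad := Finset.add_sum_erase univ (fun i => S i * lam i ^ 2) (mem_univ o)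
  have hquad' : 0 ≤ a * ∑ i ∈ univ.erase o, S i * lam i ^ 2 :=
    mul_nonneg ha.le (Finset.sum_nonneg fun i _ => mul_nonneg (hS _).le (sq_nonneg _))
  have hSo' : a * (m * lam o) ≤ 2 * (a * (S o * lam o ^ 2)) := by
    have h1 : m ≤ 2 * (lam o * S o) := hSm.trans hSo
    have := mul_le_mul_of_nonneg_left h1 (by positivity : 0 ≤ a * lam o)
    linarith only [this]
  have hβv : 0 ≤ β / v := by positivity
  have h1 := mul_le_mul_of_nonneg_left hSl hβv
  have h2 := mul_le_mul_of_nonneg_left hφw hβv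
  have h3 := mul_le_mul_of_nonneg_left hwℓ ha.le
  have h4 := mul_le_mul_of_nonneg_left hgm ha.le
  rw [← hquad] at hsum
  have hBg : a * (m * lam o) = 32 * (B * lam o) := by
    rw [← mul_assoc, haB]; ring
  have hBg' : B * lam o = 4 * C₁ * lam o + K * F ^ 2 * (2 + M) ^ 2 * lam o := by rw [hB]; ring
  have hB0 : 0 ≤ B * lam o := by rw [hBg']; positivity
  have hfin : B * lam o ≤ β / v * (n * F + n * (F * M)) :=
    sum_estimates (c := 4 * C₁) hsum hthird' hgrad hVT hcancel h1 h2 h3 hq₀'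
      (hK'.trans_eq (by rw [hB]; ring)) hquad' (hBg ▸ hSo')
      (le_of_eq_of_le (by ring) (h4.trans_eq hBg)) hB0
  have := mul_le_mul_of_nonneg_right hfin hv.le
  calc B * (lam o * v) = B * lam o * v := by ring
    _ ≤ β / v * (n * F + n * (F * M)) * v := this
    _ = β * (n * F * (1 + M)) := by field_simp

end PointEstimate

section DirectionalDerivative

variable {V : Type*} [NormedAddCommGroup V] [NormedSpace ℝ V] {Ω : Set V} {g : V → ℝ} {x : V}

/-- The derivative of `g` in the direction `v`, as a function. -/
noncomputable def dirDeriv (v : V) (g : V → ℝ) (x : V) : ℝ := fderiv ℝ g x v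

lemma ContDiffOn.dirDeriv {k l : WithTop ℕ∞} (hΩ : IsOpen Ω) (hg : ContDiffOn ℝ l g Ω)
    (hk : k + 1 ≤ l) (v : V) : ContDiffOn ℝ k (dirDeriv v g) Ω :=
  (hg.fderiv_of_isOpen hΩ hk).clm_apply contDiffOn_const

lemma hasDerivAt_line {v : V} {t : ℝ} (hg : DifferentiableAt ℝ g (x + t • v)) :
    HasDerivAt (fun t : ℝ => g (x + t • v)) (dirDeriv v g (x + t • v)) t := by
  have h : HasDerivAt (fun t : ℝ => x + t • v) v t := by
    simpa using ((hasDerivAt_id t).smul_const v).const_add x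
  exact hg.hasFDerivAt.comp_hasDerivAt t h

lemma eventually_line_mem (hΩ : IsOpen Ω) (hx : x ∈ Ω) (v : V) :
    ∀ᶠ t : ℝ in 𝓝 0, x + t • v ∈ Ω := by
  have h : ContinuousAt (fun t : ℝ => x + t • v) 0 := by fun_prop
  exact h.eventually_mem (by simpa using hΩ.mem_nhds hx)

lemma hasTwoJet_line (hΩ : IsOpen Ω) (hx : x ∈ Ω) (hg : ContDiffOn ℝ 2 g Ω) (v : V) :
    HasTwoJet (fun t => g (x + t • v)) (dirDeriv v g x) (dirDeriv v (dirDeriv v g) x) := by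
  refine ⟨fun t => dirDeriv v g (x + t • v), ?_, by simp, ?_⟩
  · filter_upwards [eventually_line_mem hΩ hx v] with t ht
    exact hasDerivAt_line ((hg.contDiffAt (hΩ.mem_nhds ht)).differentiableAt (by simp))
  · have h1 : ContDiffOn ℝ 1 (dirDeriv v g) Ω := hg.dirDeriv hΩ (by norm_num) v
    have := hasDerivAt_line (g := dirDeriv v g) (x := x) (v := v) (t := 0)
      ((h1.contDiffAt (hΩ.mem_nhds (by simpa using hx))).differentiableAt (by simp))
    simpa using this

lemma dirDeriv_dirDeriv_eq (hΩ : IsOpen Ω) (hx : x ∈ Ω) (hg : ContDiffOn ℝ 2 g Ω) (v w : V) :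
    dirDeriv v (dirDeriv w g) x = fderiv ℝ (fderiv ℝ g) x v w := by
  have h : DifferentiableAt ℝ (fderiv ℝ g) x :=
    ((hg.fderiv_of_isOpen (m := 1) hΩ (by norm_num)).contDiffAt (hΩ.mem_nhds hx)).differentiableAt
      (by simp)
  have : HasFDerivAt (dirDeriv w g) ((fderiv ℝ (fderiv ℝ g) x).flip w) x :=
    (h.hasFDerivAt.clm_apply (hasFDerivAt_const w x)).congr_fderiv (by ext; simp)
  rw [dirDeriv, this.fderiv, ContinuousLinearMap.flip_apply]

lemma dirDeriv_comm (hΩ : IsOpen Ω) (hx : x ∈ Ω) (hg : ContDiffOn ℝ 2 g Ω) (v w : V) :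
    dirDeriv v (dirDeriv w g) x = dirDeriv w (dirDeriv v g) x := by
  rw [dirDeriv_dirDeriv_eq hΩ hx hg, dirDeriv_dirDeriv_eq hΩ hx hg]
  exact (hg.contDiffAt (hΩ.mem_nhds hx)).isSymmSndFDerivAt (by simp) v w

lemma dirDeriv_congr (hΩ : IsOpen Ω) (hx : x ∈ Ω) {h : V → ℝ} (he : ∀ y ∈ Ω, g y = h y) (v : V) :
    dirDeriv v g x = dirDeriv v h x := by
  have : g =ᶠ[𝓝 x] h := by filter_upwards [hΩ.mem_nhds hx] with y hy using he y hy
  rw [dirDeriv, dirDeriv, this.fderiv_eq]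

/-- Two-jet of a composition of a `C²` function with a curve. -/
lemma hasTwoJet_comp {G : V → ℝ} (hG : ContDiff ℝ 2 G) {J J' : ℝ → V} {J₂ : V}
    (h : ∀ᶠ t in 𝓝 0, HasDerivAt J (J' t) t) (h' : HasDerivAt J' J₂ 0) :
    HasTwoJet (fun t => G (J t)) (fderiv ℝ G (J 0) (J' 0))
      (fderiv ℝ (fderiv ℝ G) (J 0) (J' 0) (J' 0) + fderiv ℝ G (J 0) J₂) := by
  refine ⟨fun t => fderiv ℝ G (J t) (J' t), ?_, rfl, ?_⟩
  · filter_upwards [h] with t ht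
    exact ((hG.differentiable (by simp)) (J t)).hasFDerivAt.comp_hasDerivAt t ht
  · have h1 : DifferentiableAt ℝ (fderiv ℝ G) (J 0) :=
      (hG.fderiv_right (m := 1) (by norm_num)).differentiable (by simp) _
    exact (h1.hasFDerivAt.comp_hasDerivAt (0 : ℝ) h.self_of_nhds).clm_apply h'

end DirectionalDerivative

section HessianBasis

variable {n : ℕ}

lemma det_bilin_add_diagonal_eq
    (Q : EuclideanSpace ℝ (Fin n) →L[ℝ] EuclideanSpace ℝ (Fin n) →L[ℝ] ℝ)
    (b c : OrthonormalBasis (Fin n) ℝ (EuclideanSpace ℝ (Fin n)))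
    (s : ℝ) :
    (Matrix.of (fun i j => Q (b i) (b j)) + Matrix.diagonal fun _ => s).det =
      (Matrix.of (fun i j => Q (c i) (c j)) + Matrix.diagonal fun _ => s).det := by
  let A : EuclideanSpace ℝ (Fin n) →ₗ[ℝ] EuclideanSpace ℝ (Fin n) :=
    ((InnerProductSpace.toDual ℝ (EuclideanSpace ℝ (Fin n))).symm.toLinearEquiv.toLinearMap).comp
    Q.toLinearMap + s • LinearMap.id
  have key : ∀ b : OrthonormalBasis (Fin n) ℝ (EuclideanSpace ℝ (Fin n)),
      (Matrix.of (fun i j => Q (b i) (b j)) + Matrix.diagonal fun _ => s).det =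
        LinearMap.det A := by
    intro b
    rw [← Matrix.det_transpose, ← LinearMap.det_toMatrix b.toBasis]
    congr 1
    ext i j
    have h1 : inner ℝ (b i)
        ((InnerProductSpace.toDual ℝ (EuclideanSpace ℝ (Fin n))).symm (Q (b j))) = Q (b j) (b i) := by
      rw [real_inner_comm, InnerProductSpace.toDual_symm_apply]
    simp [LinearMap.toMatrix_apply, A, OrthonormalBasis.repr_apply_apply, h1,
      Matrix.diagonal_apply, eq_comm]
  rw [key, key]

variable {u : EuclideanSpace ℝ (Fin n) → ℝ} {x : EuclideanSpace ℝ (Fin n)}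

lemma hessianMat_apply (i j : Fin n) : hessianMat u x i j =
    fderiv ℝ (fderiv ℝ u) x (EuclideanSpace.single i 1) (EuclideanSpace.single j 1) := by
  simp [hessianMat, iteratedFDeriv_two_apply]

lemma fderiv_fderiv_eigenvectorBasis (h : (hessianMat u x).IsHermitian) (i : Fin n)
    (v : EuclideanSpace ℝ (Fin n)) :
    fderiv ℝ (fderiv ℝ u) x (h.eigenvectorBasis i) v =
      h.eigenvalues i * inner ℝ (h.eigenvectorBasis i) v := by
  have key : ∀ j, fderiv ℝ (fderiv ℝ u) x (h.eigenvectorBasis i) (EuclideanSpace.single j 1) =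
      h.eigenvalues i * h.eigenvectorBasis i j := by
    intro j
    have h1 := congrFun (h.mulVec_eigenvectorBasis i) j
    have h2 : ∀ k, hessianMat u x j k = hessianMat u x k j := fun k => by
      simpa using congrFun (congrFun h k) j
    simp only [Matrix.mulVec, dotProduct, Pi.smul_apply, smul_eq_mul] at h1
    rw [← h1]
    conv_lhs => rw [← (EuclideanSpace.basisFun (Fin n) ℝ).sum_repr (h.eigenvectorBasis i)]
    simp only [map_sum, map_smul, _root_.sum_apply, _root_.smul_apply,
      EuclideanSpace.basisFun_apply, EuclideanSpace.basisFun_repr, smul_eq_mul]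
    refine Finset.sum_congr rfl fun k _ => ?_
    rw [h2, hessianMat_apply, mul_comm]
  conv_lhs => rw [← (EuclideanSpace.basisFun (Fin n) ℝ).sum_repr v]
  rw [← (EuclideanSpace.basisFun (Fin n) ℝ).sum_repr v]
  simp only [map_sum, map_smul, smul_eq_mul, inner_sum, inner_smul_right, Finset.mul_sum,
    EuclideanSpace.basisFun_apply, EuclideanSpace.basisFun_repr, key]
  refine Finset.sum_congr rfl fun k _ => ?_
  simp [EuclideanSpace.inner_single_right]
  ring

lemma prod_eigenvalues_add_eq_det (h : (hessianMat u x).IsHermitian)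
    (b : OrthonormalBasis (Fin n) ℝ (EuclideanSpace ℝ (Fin n))) (s : ℝ) :
    ∏ i, (h.eigenvalues i + s) = (Matrix.of (fun i j => fderiv ℝ (fderiv ℝ u) x (b i) (b j)) +
      Matrix.diagonal fun _ => s).det := by
  rw [det_bilin_add_diagonal_eq _ b h.eigenvectorBasis, ← Matrix.det_diagonal]
  congr 1
  ext i j
  simp [fderiv_fderiv_eigenvectorBasis, orthonormal_iff_ite.1 h.eigenvectorBasis.orthonormal,
    Matrix.diagonal_apply]
  split_ifs <;> simp

lemma inner_gradVec (v : EuclideanSpace ℝ (Fin n)) : inner ℝ (gradVec u x) v = fderiv ℝ u x v := by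
  conv_lhs => rw [← (EuclideanSpace.basisFun (Fin n) ℝ).sum_repr v]
  conv_rhs => rw [← (EuclideanSpace.basisFun (Fin n) ℝ).sum_repr v]
  simp [inner_sum, inner_smul_right, gradVec, EuclideanSpace.inner_single_right]

lemma gradVec_eq_sum (b : OrthonormalBasis (Fin n) ℝ (EuclideanSpace ℝ (Fin n))) :
    gradVec u x = ∑ i, dirDeriv (b i) u x • b i := by
  conv_lhs => rw [← b.sum_repr' (gradVec u x)]
  refine Finset.sum_congr rfl fun i _ => ?_
  rw [real_inner_comm, inner_gradVec, dirDeriv]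

lemma sum_hessianMat_diag (h : (hessianMat u x).IsHermitian) :
    ∑ i, hessianMat u x i i = ∑ i, h.eigenvalues i := by
  have := h.trace_eq_sum_eigenvalues
  simpa [Matrix.trace] using this

end HessianBasis

section Symmetry

variable {V : Type*} [NormedAddCommGroup V] [NormedSpace ℝ V] {Ω : Set V} {g : V → ℝ} {x : V}

lemma dirDeriv_comm_left (hΩ : IsOpen Ω) (hx : x ∈ Ω) (hg : ContDiffOn ℝ 3 g Ω) (v w z : V) :
    dirDeriv v (dirDeriv w (dirDeriv z g)) x = dirDeriv w (dirDeriv v (dirDeriv z g)) x :=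
  dirDeriv_comm hΩ hx (hg.dirDeriv hΩ (by norm_num) z) v w

lemma dirDeriv_comm_right (hΩ : IsOpen Ω) (hx : x ∈ Ω) (hg : ContDiffOn ℝ 2 g Ω) (v w z : V) :
    dirDeriv v (dirDeriv w (dirDeriv z g)) x = dirDeriv v (dirDeriv z (dirDeriv w g)) x :=
  dirDeriv_congr hΩ hx (fun _ hy => dirDeriv_comm hΩ hy hg w z) v

lemma dirDeriv_four_comm (hΩ : IsOpen Ω) (hx : x ∈ Ω) (hg : ContDiffOn ℝ 4 g Ω) (v w : V) :
    dirDeriv v (dirDeriv v (dirDeriv w (dirDeriv w g))) x =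
      dirDeriv w (dirDeriv w (dirDeriv v (dirDeriv v g))) x := by
  have h2 : ContDiffOn ℝ 2 g Ω := hg.of_le (by norm_num)
  have h3 : ∀ z, ContDiffOn ℝ 3 (dirDeriv z g) Ω := fun z => hg.dirDeriv hΩ (by norm_num) z
  calc dirDeriv v (dirDeriv v (dirDeriv w (dirDeriv w g))) x
      = dirDeriv v (dirDeriv w (dirDeriv v (dirDeriv w g))) x :=
        dirDeriv_comm_right hΩ hx ((h3 w).of_le (by norm_num)) v v w
    _ = dirDeriv w (dirDeriv v (dirDeriv v (dirDeriv w g))) x :=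
        dirDeriv_comm_left hΩ hx (h3 w) v w v
    _ = dirDeriv w (dirDeriv v (dirDeriv w (dirDeriv v g))) x :=
        dirDeriv_congr hΩ hx (fun _ hy => dirDeriv_comm_right hΩ hy h2 v v w) w
    _ = dirDeriv w (dirDeriv w (dirDeriv v (dirDeriv v g))) x :=
        dirDeriv_comm_right hΩ hx ((h3 v).of_le (by norm_num)) w v w

end Symmetry

section Equation

variable {n : ℕ} {α : ℝ} {Ω : Set (EuclideanSpace ℝ (Fin n))} {u : EuclideanSpace ℝ (Fin n) → ℝ}
  {x : EuclideanSpace ℝ (Fin n)} {b : OrthonormalBasis (Fin n) ℝ (EuclideanSpace ℝ (Fin n))}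
  {lam : Fin n → ℝ}

/-- The equation `S_n(D²u) = G(x, u, Du)` differentiated once and twice in the direction of an
eigenvector of `D²u(x)`. -/
lemma differentiated_equation (hn : 1 ≤ n) (hΩ : IsOpen Ω) (hx : x ∈ Ω) (hu : ContDiffOn ℝ 4 u Ω)
    {G : EuclideanSpace ℝ (Fin n) × ℝ × EuclideanSpace ℝ (Fin n) → ℝ} (hG : ContDiff ℝ 2 G)
    (hsym : ∀ x ∈ Ω, (hessianMat u x).IsHermitian)
    (heq : ∀ x (hx : x ∈ Ω),
      Ssum α univ (n : ℤ) ((hsym x hx).eigenvalues) = G (x, u x, gradVec u x))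
    (hdiag : ∀ p q, dirDeriv (b p) (dirDeriv (b q) u) x = Matrix.diagonal lam p q) (k : Fin n) :
    (∑ p, sumSym α lam (univ.erase p) * dirDeriv (b k) (dirDeriv (b p) (dirDeriv (b p) u)) x =
      fderiv ℝ G (x, u x, gradVec u x) (b k, dirDeriv (b k) u x, lam k • b k)) ∧
    ∑ p, sumSym α lam (univ.erase p) *
        dirDeriv (b k) (dirDeriv (b k) (dirDeriv (b p) (dirDeriv (b p) u))) x +
      ∑ p, ∑ q ∈ univ.erase p, sumSym α lam ((univ.erase p).erase q) *
        (dirDeriv (b k) (dirDeriv (b p) (dirDeriv (b p) u)) x *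
          dirDeriv (b k) (dirDeriv (b q) (dirDeriv (b q) u)) x -
        dirDeriv (b k) (dirDeriv (b p) (dirDeriv (b q) u)) x *
          dirDeriv (b k) (dirDeriv (b q) (dirDeriv (b p) u)) x) =
      fderiv ℝ (fderiv ℝ G) (x, u x, gradVec u x) (b k, dirDeriv (b k) u x, lam k • b k)
        (b k, dirDeriv (b k) u x, lam k • b k) +
      fderiv ℝ G (x, u x, gradVec u x)
        (0, lam k, ∑ i, dirDeriv (b k) (dirDeriv (b k) (dirDeriv (b i) u)) x • b i) := by
  obtain ⟨d, s, hds⟩ := exists_sumSym_eq_sum_prod n α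
  have h3 : ∀ v, ContDiffOn ℝ 3 (dirDeriv v u) Ω := fun v => hu.dirDeriv hΩ (by norm_num) v
  have h2 : ∀ v w, ContDiffOn ℝ 2 (dirDeriv v (dirDeriv w u)) Ω := fun v w =>
    (h3 w).dirDeriv hΩ (by norm_num) v
  have hdiff : ∀ {g : EuclideanSpace ℝ (Fin n) → ℝ} {y}, ContDiffOn ℝ 2 g Ω → y ∈ Ω →
      DifferentiableAt ℝ g y := fun hg hy =>
    (hg.contDiffAt (hΩ.mem_nhds hy)).differentiableAt (by simp)
  have hleft := hasTwoJet_sum_det hds (lam := lam)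
    (H := fun t => Matrix.of fun p q => dirDeriv (b p) (dirDeriv (b q) u) (x + t • b k))
    (H₁ := Matrix.of fun p q => dirDeriv (b k) (dirDeriv (b p) (dirDeriv (b q) u)) x)
    (H₂ := Matrix.of fun p q =>
      dirDeriv (b k) (dirDeriv (b k) (dirDeriv (b p) (dirDeriv (b q) u))) x)
    (fun p q => hasTwoJet_line hΩ hx (h2 _ _) (b k)) (by ext p q; simp [hdiag])
  let J : ℝ → EuclideanSpace ℝ (Fin n) × ℝ × EuclideanSpace ℝ (Fin n) := fun t =>
    (x + t • b k, u (x + t • b k), ∑ i, dirDeriv (b i) u (x + t • b k) • b i)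
  let J' : ℝ → EuclideanSpace ℝ (Fin n) × ℝ × EuclideanSpace ℝ (Fin n) := fun t =>
    (b k, dirDeriv (b k) u (x + t • b k),
      ∑ i, dirDeriv (b k) (dirDeriv (b i) u) (x + t • b k) • b i)
  have hline : ∀ t : ℝ, HasDerivAt (fun t : ℝ => x + t • b k) (b k) t := fun t => by
    simpa using ((hasDerivAt_id t).smul_const (b k)).const_add x
  have hJ : ∀ᶠ t in 𝓝 0, HasDerivAt J (J' t) t := by
    filter_upwards [eventually_line_mem hΩ hx (b k)] with t ht
    refine (hline t).prodMk ((hasDerivAt_line (hdiff (hu.of_le (by norm_num)) ht)).prodMk ?_)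
    exact HasDerivAt.fun_sum fun i _ =>
      (hasDerivAt_line (hdiff ((h3 _).of_le (by norm_num)) ht)).smul_const (b i)
  have hx0 : x + (0 : ℝ) • b k ∈ Ω := by simpa using hx
  have hJ' : HasDerivAt J' (0, lam k,
      ∑ i, dirDeriv (b k) (dirDeriv (b k) (dirDeriv (b i) u)) x • b i) 0 := by
    have e1 : lam k = dirDeriv (b k) (dirDeriv (b k) u) (x + (0 : ℝ) • b k) := by simp [hdiag]
    rw [e1]
    refine (hasDerivAt_const _ _).prodMk
      ((hasDerivAt_line (hdiff ((h3 _).of_le (by norm_num)) hx0)).prodMk ?_)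
    refine HasDerivAt.fun_sum fun i _ => HasDerivAt.smul_const ?_ (b i)
    simpa using hasDerivAt_line (hdiff (h2 (b k) (b i)) hx0)
  have hright := hasTwoJet_comp hG hJ hJ'
  have hJ0 : J 0 = (x, u x, gradVec u x) := by simp [J, gradVec_eq_sum b]
  have hJ'0 : J' 0 = (b k, dirDeriv (b k) u x, lam k • b k) := by
    simp [J', hdiag, Matrix.diagonal_apply, ite_smul]
  rw [hJ0, hJ'0] at hright
  refine hleft.unique hright ?_
  filter_upwards [eventually_line_mem hΩ hx (b k)] with t ht
  have h4 := heq _ ht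
  rw [Ssum_univ_eq_sumSym hn, hds] at h4
  simp only [J, ← gradVec_eq_sum, ← h4]
  refine Finset.sum_congr rfl fun j _ => ?_
  rw [prod_eigenvalues_add_eq_det _ b]
  congr 3
  ext p q
  simp [dirDeriv_dirDeriv_eq hΩ ht (hu.of_le (by norm_num))]

end Equation

section MaximumPoint

variable {n : ℕ} {Ω : Set (EuclideanSpace ℝ (Fin n))} {u : EuclideanSpace ℝ (Fin n) → ℝ}
  {x : EuclideanSpace ℝ (Fin n)} {b : OrthonormalBasis (Fin n) ℝ (EuclideanSpace ℝ (Fin n))}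
  {lam : Fin n → ℝ} {o : Fin n}

lemma norm_add_smul_sum_sq (c : Fin n → ℝ) (t : ℝ) :
    ‖b o + t • ∑ q ∈ univ.erase o, c q • b q‖ ^ 2 =
      1 + t * (t * ∑ q ∈ univ.erase o, c q ^ 2) := by
  have hb := orthonormal_iff_ite.1 b.orthonormal
  have h1 : inner ℝ (b o) (∑ q ∈ univ.erase o, c q • b q) = 0 := by
    rw [inner_sum]
    refine Finset.sum_eq_zero fun q hq => ?_
    rw [inner_smul_right, hb, if_neg (ne_of_mem_erase hq).symm, mul_zero]
  have h2 : ‖∑ q ∈ univ.erase o, c q • b q‖ ^ 2 = ∑ q ∈ univ.erase o, c q ^ 2 := by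
    rw [← real_inner_self_eq_norm_sq, b.orthonormal.inner_sum]
    simp [sq]
  rw [norm_add_sq_real, norm_smul, mul_pow, h2, inner_smul_right, h1]
  simp
  ring

lemma bilin_add_smul_sum (Q : EuclideanSpace ℝ (Fin n) →L[ℝ] EuclideanSpace ℝ (Fin n) →L[ℝ] ℝ)
    (hQ : ∀ v w, Q v w = Q w v) (c : Fin n → ℝ) (t : ℝ) :
    Q (b o + t • ∑ q ∈ univ.erase o, c q • b q) (b o + t • ∑ q ∈ univ.erase o, c q • b q) =
      Q (b o) (b o) + 2 * (t * ∑ q ∈ univ.erase o, c q * Q (b o) (b q)) +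
        t * (t * ∑ q ∈ univ.erase o, ∑ r ∈ univ.erase o, c q * (c r * Q (b q) (b r))) := by
  have h1 : Q (b o) (∑ q ∈ univ.erase o, c q • b q) =
      ∑ q ∈ univ.erase o, c q * Q (b o) (b q) := by simp
  have h2 : Q (∑ q ∈ univ.erase o, c q • b q) (∑ q ∈ univ.erase o, c q • b q) =
      ∑ q ∈ univ.erase o, ∑ r ∈ univ.erase o, c q * (c r * Q (b q) (b r)) := by
    simp only [map_sum, map_smul, _root_.sum_apply, _root_.smul_apply, smul_eq_mul, Finset.mul_sum]
    exact Finset.sum_congr rfl fun q _ => Finset.sum_congr rfl fun r _ => by rw [hQ]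
  simp only [map_add, map_smul, _root_.add_apply, _root_.smul_apply, smul_eq_mul]
  rw [h2, hQ (∑ q ∈ univ.erase o, c q • b q) (b o), h1]
  ring

/-- First and second order conditions at a local maximum of
`(-u)^β D²u(ξ,ξ) |ξ|⁻² exp (a |Du|² / 2)`, along a direction adapted to the third derivatives. -/
lemma maximum_conditions (hΩ : IsOpen Ω) (hx : x ∈ Ω) (hu : ContDiffOn ℝ 4 u Ω)
    (hdiag : ∀ p q, dirDeriv (b p) (dirDeriv (b q) u) x = Matrix.diagonal lam p q)
    {β a : ℝ} (hux : u x < 0) (hlo : 0 < lam o)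
    (hmax : ∀ᶠ y in 𝓝 x, ∀ ξ, (-u y) ^ β * fderiv ℝ (fderiv ℝ u) y ξ ξ *
        Real.exp (a / 2 * ∑ k, dirDeriv (b k) u y ^ 2) ≤
      (-u x) ^ β * lam o * Real.exp (a / 2 * ∑ k, dirDeriv (b k) u x ^ 2) * ‖ξ‖ ^ 2) (i : Fin n) :
    dirDeriv (b i) (dirDeriv (b o) (dirDeriv (b o) u)) x / lam o =
        β * dirDeriv (b i) u x / -u x - a * dirDeriv (b i) u x * lam i ∧
    β * (-lam i / -u x - dirDeriv (b i) u x ^ 2 / (-u x) ^ 2) +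
      (dirDeriv (b i) (dirDeriv (b i) (dirDeriv (b o) (dirDeriv (b o) u))) x / lam o +
        ∑ q ∈ univ.erase o, (2 + 2 * lam q / lam o) *
          dirDeriv (b i) (dirDeriv (b o) (dirDeriv (b q) u)) x ^ 2 / lam o ^ 2) -
      dirDeriv (b i) (dirDeriv (b o) (dirDeriv (b o) u)) x ^ 2 / lam o ^ 2 +
      a * (lam i ^ 2 + ∑ k, dirDeriv (b k) u x *
        dirDeriv (b i) (dirDeriv (b i) (dirDeriv (b k) u)) x) ≤ 0 := by
  have h3 : ∀ v, ContDiffOn ℝ 3 (dirDeriv v u) Ω := fun v => hu.dirDeriv hΩ (by norm_num) v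
  have h2 : ∀ v w, ContDiffOn ℝ 2 (dirDeriv v (dirDeriv w u)) Ω := fun v w =>
    (h3 w).dirDeriv hΩ (by norm_num) v
  have hu2 : ContDiffOn ℝ 2 u Ω := hu.of_le (by norm_num)
  set T : Fin n → Fin n → ℝ := fun p q => dirDeriv (b i) (dirDeriv (b p) (dirDeriv (b q) u)) x
    with hT
  set c : Fin n → ℝ := fun q => T o q / lam o with hc
  let N : ℝ → ℝ := fun t => dirDeriv (b o) (dirDeriv (b o) u) (x + t • b i) +
    2 * (t * ∑ q ∈ univ.erase o, c q * dirDeriv (b o) (dirDeriv (b q) u) (x + t • b i)) +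
    t * (t * ∑ q ∈ univ.erase o, ∑ r ∈ univ.erase o,
      c q * (c r * dirDeriv (b q) (dirDeriv (b r) u) (x + t • b i)))
  let R : ℝ → ℝ := fun t => 1 + t * (t * ∑ q ∈ univ.erase o, c q ^ 2)
  have jU : ∀ p q, HasTwoJet (fun t => dirDeriv (b p) (dirDeriv (b q) u) (x + t • b i)) (T p q)
      (dirDeriv (b i) (dirDeriv (b i) (dirDeriv (b p) (dirDeriv (b q) u))) x) := fun p q =>
    hasTwoJet_line hΩ hx (h2 _ _) (b i)
  have hz : ∑ q ∈ univ.erase o, c q * dirDeriv (b o) (dirDeriv (b q) u) (x + (0 : ℝ) • b i) = 0 :=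
    Finset.sum_eq_zero fun q hq => by
      simp [hdiag, Matrix.diagonal_apply_ne lam (ne_of_mem_erase hq).symm]
  have hzz : ∑ q ∈ univ.erase o, ∑ r ∈ univ.erase o,
      c q * (c r * dirDeriv (b q) (dirDeriv (b r) u) (x + (0 : ℝ) • b i)) =
      ∑ q ∈ univ.erase o, c q ^ 2 * lam q := by
    refine Finset.sum_congr rfl fun q hq => ?_
    rw [Finset.sum_eq_single_of_mem q hq fun r _ hr => by
      simp [hdiag, Matrix.diagonal_apply_ne lam hr.symm]]
    simp [hdiag]
    ring
  have jN : HasTwoJet N (T o o)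
      (dirDeriv (b i) (dirDeriv (b i) (dirDeriv (b o) (dirDeriv (b o) u))) x +
        4 * ∑ q ∈ univ.erase o, c q * T o q + 2 * ∑ q ∈ univ.erase o, c q ^ 2 * lam q) := by
    have k1 := HasTwoJet.id'.mul (HasTwoJet.sum (s := univ.erase o) fun q _ =>
      (jU o q).const_mul (c q))
    have k2 := HasTwoJet.id'.mul (HasTwoJet.id'.mul (HasTwoJet.sum (s := univ.erase o) fun q _ =>
      HasTwoJet.sum (s := univ.erase o) fun r _ => ((jU q r).const_mul (c r)).const_mul (c q)))
    rw [hz] at k1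
    rw [hzz] at k2
    convert ((jU o o).add (k1.const_mul 2)).add k2 using 1
    · ring
    · ring
  have jR : HasTwoJet R 0 (2 * ∑ q ∈ univ.erase o, c q ^ 2) := by
    convert (HasTwoJet.const 1).add (HasTwoJet.id'.mul (HasTwoJet.id'.mul
      (HasTwoJet.const (∑ q ∈ univ.erase o, c q ^ 2)))) using 1
    · ring
    · ring
  have hN0 : N 0 = lam o := by simp [N, hdiag]
  have hR0 : R 0 = 1 := by simp [R]
  have jv : HasTwoJet (fun t => -1 * u (x + t • b i)) (-1 * dirDeriv (b i) u x) (-1 * lam i) := by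
    have := (hasTwoJet_line hΩ hx hu2 (b i)).const_mul (-1)
    simpa [hdiag] using this
  have jP : HasTwoJet (fun t => ∑ k, dirDeriv (b k) u (x + t • b i) ^ 2)
      (2 * (dirDeriv (b i) u x * lam i)) (2 * (lam i ^ 2 + ∑ k, dirDeriv (b k) u x *
        dirDeriv (b i) (dirDeriv (b i) (dirDeriv (b k) u)) x)) := by
    have k1 := fun k => hasTwoJet_line hΩ hx ((h3 (b k)).of_le (by norm_num)) (b i)
    have k2 := HasTwoJet.sum (s := univ) fun k (_ : k ∈ univ) => (k1 k).mul (k1 k)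
    simp only [← sq, zero_smul, add_zero, hdiag] at k2
    convert k2 using 1
    · simp [Matrix.diagonal_apply, Finset.sum_add_distrib]
      ring
    · simp only [Finset.sum_add_distrib, ← Finset.mul_sum]
      have e : ∑ k, Matrix.diagonal lam i k ^ 2 = lam i ^ 2 := by simp [Matrix.diagonal_apply]
      rw [e, Finset.sum_congr rfl fun k _ => mul_comm _ (dirDeriv (b k) u x)]
      ring
  have hv0 : -1 * u (x + (0 : ℝ) • b i) = -u x := by simp
  have hv0' : -1 * u (x + (0 : ℝ) • b i) ≠ 0 := by rw [hv0]; linarith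
  have jψ := ((((jv.log hv0').const_mul β).add (jN.log (by rw [hN0]; exact hlo.ne'))).add
    ((jR.log (by rw [hR0]; exact one_ne_zero)).const_mul (-1))).add (jP.const_mul (a / 2))
  rw [hv0, hN0, hR0] at jψ
  have hline : ContinuousAt (fun t : ℝ => x + t • b i) 0 := by fun_prop
  have htend : Filter.Tendsto (fun t : ℝ => x + t • b i) (𝓝 0) (𝓝 x) := by
    simpa [ContinuousAt] using hline
  have hmax' := jψ.of_isLocalMax (by
    have hNpos : ∀ᶠ t in 𝓝 0, 0 < N t := by
      have := jN.continuousAt.eventually_const_lt (u := 0) (by rw [hN0]; exact hlo)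
      exact this
    have hvpos : ∀ᶠ t in 𝓝 (0 : ℝ), 0 < -1 * u (x + t • b i) :=
      jv.continuousAt.eventually_const_lt (u := 0) (by simpa using hux)
    filter_upwards [hNpos, hvpos, htend.eventually hmax, eventually_line_mem hΩ hx (b i)]
      with t htN htv hty hmem
    have h4 := hty (b o + t • ∑ q ∈ univ.erase o, c q • b q)
    have hsymm : ∀ v w, fderiv ℝ (fderiv ℝ u) (x + t • b i) v w =
        fderiv ℝ (fderiv ℝ u) (x + t • b i) w v := fun v w => by
      rw [← dirDeriv_dirDeriv_eq hΩ hmem hu2, dirDeriv_comm hΩ hmem hu2,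
        dirDeriv_dirDeriv_eq hΩ hmem hu2]
    have hR : 0 < R t := by
      have : 0 ≤ t ^ 2 * ∑ q ∈ univ.erase o, c q ^ 2 :=
        mul_nonneg (sq_nonneg _) (Finset.sum_nonneg fun _ _ => sq_nonneg _)
      have e : R t = 1 + t ^ 2 * ∑ q ∈ univ.erase o, c q ^ 2 := by simp only [R]; ring
      rw [e]; linarith
    rw [bilin_add_smul_sum _ hsymm, norm_add_smul_sum_sq] at h4
    simp only [← dirDeriv_dirDeriv_eq hΩ hmem hu2] at h4
    rw [neg_one_mul] at htv
    have hvx : 0 < -u x := by linarith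
    have h5 := Real.log_le_log (mul_pos (mul_pos (Real.rpow_pos_of_pos htv β) htN)
      (Real.exp_pos _)) h4
    change Real.log (_ * N t * _) ≤ Real.log (_ * R t) at h5
    have hp := Real.rpow_pos_of_pos htv β
    have hpx := Real.rpow_pos_of_pos hvx β
    rw [Real.log_mul (mul_pos hp htN).ne' (Real.exp_pos _).ne', Real.log_mul hp.ne' htN.ne',
      Real.log_rpow htv, Real.log_exp,
      Real.log_mul (mul_pos (mul_pos hpx hlo) (Real.exp_pos _)).ne' hR.ne',
      Real.log_mul (mul_pos hpx hlo).ne' (Real.exp_pos _).ne', Real.log_mul hpx.ne' hlo.ne',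
      Real.log_rpow hvx, Real.log_exp] at h5
    simp only [neg_one_mul, hN0, hR0, Real.log_one, zero_smul, add_zero]
    linarith)
  obtain ⟨hm1, hm2⟩ := hmax'
  constructor
  · have : T o o / lam o = β * dirDeriv (b i) u x / -u x - a * dirDeriv (b i) u x * lam i := by
      linear_combination hm1
    exact this
  · refine le_of_eq_of_le ?_ hm2
    have e : ∑ q ∈ univ.erase o, (2 + 2 * lam q / lam o) * T o q ^ 2 / lam o ^ 2 =
        (4 * ∑ q ∈ univ.erase o, c q * T o q + 2 * ∑ q ∈ univ.erase o, c q ^ 2 * lam q) / lam o -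
          2 * ∑ q ∈ univ.erase o, c q ^ 2 := by
      rw [Finset.mul_sum, Finset.mul_sum, Finset.mul_sum, ← Finset.sum_add_distrib, Finset.sum_div,
        ← Finset.sum_sub_distrib]
      refine Finset.sum_congr rfl fun q _ => ?_
      simp only [hc]
      field_simp
      ring
    change _ + (_ + ∑ q ∈ univ.erase o, (2 + 2 * lam q / lam o) * T o q ^ 2 / lam o ^ 2) - 
      T o o ^ 2 / lam o ^ 2 + _ = _
    rw [e]
    ring

end MaximumPoint

section MaximumPointEstimate

variable {n : ℕ} {α : ℝ} {Ω : Set (EuclideanSpace ℝ (Fin n))} {u : EuclideanSpace ℝ (Fin n) → ℝ}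
  {x : EuclideanSpace ℝ (Fin n)}

lemma abs_fderiv_apply_le {V : Type*} [NormedAddCommGroup V] [NormedSpace ℝ V] {G : V → ℝ} {p : V}
    {F : ℝ} (h : ‖iteratedFDeriv ℝ 1 G p‖ ≤ F) {v : V} {c : ℝ} (hv : ‖v‖ ≤ c) :
    |fderiv ℝ G p v| ≤ F * c := by
  rw [← norm_iteratedFDeriv_fderiv, norm_iteratedFDeriv_zero] at h
  rw [← Real.norm_eq_abs]
  exact (fderiv ℝ G p).le_of_opNorm_le_of_le h hv

lemma abs_fderiv_fderiv_apply_le {V : Type*} [NormedAddCommGroup V] [NormedSpace ℝ V] {G : V → ℝ}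
    {p : V} {F : ℝ} (h : ‖iteratedFDeriv ℝ 2 G p‖ ≤ F) {v : V} {c : ℝ} (hv : ‖v‖ ≤ c) :
    |fderiv ℝ (fderiv ℝ G) p v v| ≤ F * c ^ 2 := by
  have h1 := (iteratedFDeriv ℝ 2 G p).le_opNorm ![v, v]
  rw [iteratedFDeriv_two_apply, Real.norm_eq_abs] at h1
  simp only [Fin.prod_univ_two, Matrix.cons_val_zero, Matrix.cons_val_one] at h1
  refine h1.trans ?_
  rw [sq]
  have hF := (norm_nonneg _).trans h
  have hc := (norm_nonneg _).trans hv
  gcongr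

/-- The Pogorelov estimate at an interior maximum point of the auxiliary function
`(-u)^β D²u(ξ,ξ) |ξ|⁻² exp (a |Du|² / 2)`. -/
lemma maximum_point_estimate (hn : 2 ≤ n) {m M F a β K B C₁ : ℝ} (hα : 0 < α) (hm : 0 < m)
    (hM : 0 < M) (hF : 0 < F) (ha : 0 < a) (hβ : 4 ≤ β) (hβa : 4 * a * M ^ 2 ≤ β)
    (hK : 2 * (1 + 2 * n) ≤ K * m) (hK0 : 0 < K) (hC₁ : C₁ = F * (1 + M) ^ 2 + F)
    (hB : B = 4 * C₁ + K * F ^ 2 * (2 + M) ^ 2) (haB : a * m = 32 * B)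
    (hΩ : IsOpen Ω) (hx : x ∈ Ω) (hu : ContDiffOn ℝ 4 u Ω)
    {G : EuclideanSpace ℝ (Fin n) × ℝ × EuclideanSpace ℝ (Fin n) → ℝ} (hG : ContDiff ℝ 2 G)
    (hGm : m ≤ G (x, u x, gradVec u x))
    (hGF : ∀ j : ℕ, j ≤ 2 → ‖iteratedFDeriv ℝ j G (x, u x, gradVec u x)‖ ≤ F)
    (hsym : ∀ x ∈ Ω, (hessianMat u x).IsHermitian)
    (hcone : (hsym x hx).eigenvalues ∈ GammaTilde n n α)
    (heq : ∀ x (hx : x ∈ Ω),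
      Ssum α univ (n : ℤ) ((hsym x hx).eigenvalues) = G (x, u x, gradVec u x))
    (hux : u x < 0) (hgrad : ‖gradVec u x‖ ≤ M) (o : Fin n)
    (hmax : ∀ᶠ y in 𝓝 x, ∀ ξ, (-u y) ^ β * fderiv ℝ (fderiv ℝ u) y ξ ξ *
        Real.exp (a / 2 * ‖gradVec u y‖ ^ 2) ≤
      (-u x) ^ β * (hsym x hx).eigenvalues o * Real.exp (a / 2 * ‖gradVec u x‖ ^ 2) * ‖ξ‖ ^ 2)
    (hg1 : 1 ≤ (hsym x hx).eigenvalues o) (hg : 4 ≤ α * (hsym x hx).eigenvalues o)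
    (hgm : 16 * (n * M * F * (1 + M)) ≤ m * (hsym x hx).eigenvalues o)
    (hbig : 4 * β * M ^ 2 ≤ a * ((hsym x hx).eigenvalues o * -u x) ^ 2) :
    B * ((hsym x hx).eigenvalues o * -u x) ≤ β * (n * F * (1 + M)) := by
  have heqx := heq x hx
  set b := (hsym x hx).eigenvectorBasis with hb
  have hdiag : ∀ p q, dirDeriv (b p) (dirDeriv (b q) u) x =
      Matrix.diagonal (hsym x hx).eigenvalues p q := fun p q => by
    rw [dirDeriv_dirDeriv_eq hΩ hx (hu.of_le (by norm_num)), hb, fderiv_fderiv_eigenvectorBasis,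
      orthonormal_iff_ite.1 (hsym x hx).eigenvectorBasis.orthonormal, Matrix.diagonal_apply]
    split_ifs <;> simp
  have hdiff := differentiated_equation (by omega) hΩ hx hu hG hsym heq hdiag
  set lam := (hsym x hx).eigenvalues with hlam
  have hgsq : ∀ y, ∑ k, dirDeriv (b k) u y ^ 2 = ‖gradVec u y‖ ^ 2 := fun y => by
    rw [← real_inner_self_eq_norm_sq, gradVec_eq_sum b, b.orthonormal.inner_sum]
    simp [sq]
  have hcond := maximum_conditions (o := o) (β := β) (a := a) hΩ hx hu hdiag hux (by linarith)
    (by simpa only [hgsq] using hmax)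
  have hw : ∀ i, |dirDeriv (b i) u x| ≤ M := fun i => by
    have h1 : dirDeriv (b i) u x ^ 2 ≤ ‖gradVec u x‖ ^ 2 := by
      rw [← hgsq]
      exact Finset.single_le_sum (f := fun k => dirDeriv (b k) u x ^ 2)
        (fun k _ => sq_nonneg _) (mem_univ i)
    exact (abs_le_of_sq_le_sq h1 (norm_nonneg _)).trans hgrad
  have hpos : ∀ i j, i ≠ j → lam i ≤ 0 → 0 < lam j := pos_of_mem_Gamma hn hcone.1
  rw [Ssum_univ_eq_sumSym (by omega)] at heqx
  have hu3 : ContDiffOn ℝ 3 u Ω := hu.of_le (by norm_num)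
  have hu2 : ContDiffOn ℝ 2 u Ω := hu.of_le (by norm_num)
  have hcomm : ∀ i q, dirDeriv (b i) (dirDeriv (b o) (dirDeriv (b q) u)) x =
      dirDeriv (b o) (dirDeriv (b i) (dirDeriv (b q) u)) x := fun i q =>
    dirDeriv_comm_left hΩ hx hu3 _ _ _
  have hbn : ∀ i, ‖b i‖ = 1 := fun i => b.orthonormal.1 i
  have hℓ : ∀ k, |fderiv ℝ G (x, u x, gradVec u x) (b k, dirDeriv (b k) u x, 0)| ≤ F * (1 + M) :=
    fun k => abs_fderiv_apply_le (hGF 1 (by norm_num)) (by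
      have := hw k
      simp only [Prod.norm_def, hbn, Real.norm_eq_abs, norm_zero]
      exact max_le (by linarith) (max_le (by linarith) (by linarith)))
  have hφ : ∀ k, |fderiv ℝ G (x, u x, gradVec u x) (0, 0, b k)| ≤ F := fun k => by
    simpa using abs_fderiv_apply_le (c := 1) (hGF 1 (by norm_num)) (v := (0, 0, b k))
      (by simp [Prod.norm_def, hbn])
  have hsplit : ∀ k, fderiv ℝ G (x, u x, gradVec u x) (b k, dirDeriv (b k) u x, lam k • b k) =
      fderiv ℝ G (x, u x, gradVec u x) (b k, dirDeriv (b k) u x, 0) +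
        lam k * fderiv ℝ G (x, u x, gradVec u x) (0, 0, b k) := fun k => by
    rw [← smul_eq_mul, ← (fderiv ℝ G (x, u x, gradVec u x)).map_smul, ← map_add]
    simp
  have hsplit' : fderiv ℝ G (x, u x, gradVec u x)
        (0, lam o, ∑ i, dirDeriv (b o) (dirDeriv (b o) (dirDeriv (b i) u)) x • b i) =
      lam o * fderiv ℝ G (x, u x, gradVec u x) (0, 1, 0) +
        ∑ i, fderiv ℝ G (x, u x, gradVec u x) (0, 0, b i) *
          dirDeriv (b o) (dirDeriv (b o) (dirDeriv (b i) u)) x := by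
    have e : ((0, lam o, ∑ i, dirDeriv (b o) (dirDeriv (b o) (dirDeriv (b i) u)) x • b i) :
        EuclideanSpace ℝ (Fin n) × ℝ × EuclideanSpace ℝ (Fin n)) = lam o • (0, 1, 0) +
        ∑ i, dirDeriv (b o) (dirDeriv (b o) (dirDeriv (b i) u)) x • (0, 0, b i) := by
      ext1
      · simp [Prod.fst_sum]
      · ext1 <;> simp [Prod.fst_sum, Prod.snd_sum]
    rw [e, map_add, map_smul, map_sum, smul_eq_mul]
    congr 1
    exact Finset.sum_congr rfl fun i _ => by rw [map_smul, smul_eq_mul, mul_comm]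
  have hq₀ : -(C₁ * (1 + lam o) ^ 2) ≤
      fderiv ℝ (fderiv ℝ G) (x, u x, gradVec u x) (b o, dirDeriv (b o) u x, lam o • b o)
        (b o, dirDeriv (b o) u x, lam o • b o) +
      lam o * fderiv ℝ G (x, u x, gradVec u x) (0, 1, 0) := by
    have h1 := abs_fderiv_fderiv_apply_le (hGF 2 le_rfl)
      (v := (b o, dirDeriv (b o) u x, lam o • b o)) (c := 1 + M + lam o) (by
        have := hw o
        simp only [Prod.norm_def, hbn, Real.norm_eq_abs, norm_smul, mul_one,
          abs_of_pos (by linarith : 0 < lam o)]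
        exact max_le (by linarith) (max_le (by linarith) (by linarith)))
    have h2 : |fderiv ℝ G (x, u x, gradVec u x) (0, 1, 0)| ≤ F := by
      simpa using abs_fderiv_apply_le (c := 1) (hGF 1 (by norm_num)) (v := (0, 1, 0))
        (by simp [Prod.norm_def])
    have h3 := mul_le_mul_of_nonneg_left (abs_le.1 h2).1 (by linarith : 0 ≤ lam o)
    have h4 := (abs_le.1 h1).1
    have h5 : (1 + M + lam o) ^ 2 ≤ ((1 + M) * (1 + lam o)) ^ 2 :=
      pow_le_pow_left₀ (by linarith) (by nlinarith only [hM, hg1]) 2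
    have h6 := mul_le_mul_of_nonneg_left h5 hF.le
    have h7 : F * lam o ≤ F * (1 + lam o) ^ 2 :=
      mul_le_mul_of_nonneg_left (by nlinarith only [hg1]) hF.le
    rw [hC₁]
    linarith only [h3, h4, h6, h7]
  refine point_estimate (W := fun p q => dirDeriv (b o) (dirDeriv (b p) (dirDeriv (b q) u)) x)
    (w := fun i => dirDeriv (b i) u x)
    (φ := fun k => fderiv ℝ G (x, u x, gradVec u x) (0, 0, b k))
    (ℓ := fun k => fderiv ℝ G (x, u x, gradVec u x) (b k, dirDeriv (b k) u x, 0))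
    (V := fun i => dirDeriv (b i) (dirDeriv (b i) (dirDeriv (b o) (dirDeriv (b o) u))) x)
    (X := fun i => ∑ k, dirDeriv (b k) u x *
        dirDeriv (b i) (dirDeriv (b i) (dirDeriv (b k) u)) x)
    hα hm hM hF (neg_pos.2 hux) ha hβ hβa hpos
    (sumSym_pos_of_univ hα hpos (by rw [heqx]; linarith)) (by rw [heqx]; exact hGm) ?_
    (sum_prod_erase_pos hn hcone.1).le hw hφ hℓ
    (fun p q => dirDeriv_comm_right hΩ hx hu2 _ _ _) ?_ ?_ ?_ hq₀ (by rw [hC₁]; positivity) ?_ ?_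
    hK hK0 hB haB hg1 hg hgm hbig
  · rw [heqx]
    have h1 := hGF 0 (by norm_num)
    rw [norm_iteratedFDeriv_zero, Real.norm_eq_abs] at h1
    exact (le_abs_self _).trans h1
  · simp only [← hsplit, ← (hdiff _).1, Finset.mul_sum]
    rw [Finset.sum_comm]
    refine Finset.sum_congr rfl fun k _ => Finset.sum_congr rfl fun i _ => ?_
    rw [dirDeriv_comm_right hΩ hx hu2 (b i) (b i), dirDeriv_comm_left hΩ hx hu3 (b i) (b k)]
    ring
  · simpa only [← hsplit] using (hdiff o).1
  · have h1 := (hdiff o).2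
    rw [hsplit'] at h1
    rw [add_assoc, ← h1]
    congr 1
    exact Finset.sum_congr rfl fun p _ => by rw [dirDeriv_four_comm hΩ hx hu]
  · intro i
    rw [← (hcond i).1, hcomm i o, dirDeriv_comm_right hΩ hx hu2 (b o) (b i)]
  · intro i
    have h1 := (hcond i).2
    simp only [hcomm] at h1
    rwa [dirDeriv_comm_right hΩ hx hu2 (b o) (b i) (b o)] at h1

end MaximumPointEstimate

section Global

variable {n : ℕ} {α : ℝ} {Ω : Set (EuclideanSpace ℝ (Fin n))} {u : EuclideanSpace ℝ (Fin n) → ℝ}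
  {x : EuclideanSpace ℝ (Fin n)}

lemma fderiv_fderiv_self_le (h : (hessianMat u x).IsHermitian) {o : Fin n}
    (ho : ∀ i, h.eigenvalues i ≤ h.eigenvalues o) (ξ : EuclideanSpace ℝ (Fin n)) :
    fderiv ℝ (fderiv ℝ u) x ξ ξ ≤ h.eigenvalues o * ‖ξ‖ ^ 2 := by
  have h1 : fderiv ℝ (fderiv ℝ u) x ξ ξ =
      ∑ i, h.eigenvalues i * inner ℝ (h.eigenvectorBasis i) ξ ^ 2 := by
    have e : fderiv ℝ (fderiv ℝ u) x ξ =
        ∑ i, inner ℝ (h.eigenvectorBasis i) ξ • fderiv ℝ (fderiv ℝ u) x (h.eigenvectorBasis i) := by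
      conv_lhs => rw [← h.eigenvectorBasis.sum_repr' ξ]
      simp only [map_sum, map_smul]
    rw [e, _root_.sum_apply]
    refine Finset.sum_congr rfl fun i _ => ?_
    rw [_root_.smul_apply, fderiv_fderiv_eigenvectorBasis, smul_eq_mul]
    ring
  have h2 : ‖ξ‖ ^ 2 = ∑ i, inner ℝ (h.eigenvectorBasis i) ξ ^ 2 := by
    rw [← h.eigenvectorBasis.sum_sq_norm_inner_right ξ]
    simp
  rw [h1, h2, Finset.mul_sum]
  exact Finset.sum_le_sum fun i _ => mul_le_mul_of_nonneg_right (ho i) (sq_nonneg _)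

lemma fderiv_fderiv_eigenvectorBasis_self (h : (hessianMat u x).IsHermitian) (i : Fin n) :
    fderiv ℝ (fderiv ℝ u) x (h.eigenvectorBasis i) (h.eigenvectorBasis i) = h.eigenvalues i := by
  rw [fderiv_fderiv_eigenvectorBasis, real_inner_self_eq_norm_sq, h.eigenvectorBasis.orthonormal.1]
  simp

lemma exists_pos_of_mem_GammaTilde (hn : 2 ≤ n) {lam : Fin n → ℝ} (h : lam ∈ GammaTilde n n α) :
    ∃ i, 0 < lam i := by
  by_contra! hneg
  have hne : (⟨0, by omega⟩ : Fin n) ≠ ⟨1, by omega⟩ := by simp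
  exact absurd (pos_of_mem_Gamma hn h.1 _ _ hne (hneg _)) (not_lt.2 (hneg _))

lemma nonpos_of_frontier (hn : 2 ≤ n) (hΩ : IsOpen Ω) (hb : Bornology.IsBounded Ω)
    (hu : ContDiffOn ℝ 4 u Ω) (hcont : ContinuousOn u (closure Ω))
    (hfr : ∀ x ∈ frontier Ω, u x = 0) (hsym : ∀ x ∈ Ω, (hessianMat u x).IsHermitian)
    (hcone : ∀ x (hx : x ∈ Ω), (hsym x hx).eigenvalues ∈ GammaTilde n n α) (hx : x ∈ Ω) :
    u x ≤ 0 := by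
  obtain ⟨y, hy, hmax⟩ := hb.isCompact_closure.exists_isMaxOn ⟨x, subset_closure hx⟩ hcont
  refine (hmax (subset_closure hx)).trans ?_
  change u y ≤ 0
  by_contra! hpos
  have hyΩ : y ∈ Ω := by
    by_contra hyn
    have := hfr y ⟨hy, by rwa [hΩ.interior_eq]⟩
    linarith
  obtain ⟨i, hi⟩ := exists_pos_of_mem_GammaTilde hn (hcone y hyΩ)
  have hu2 : ContDiffOn ℝ 2 u Ω := hu.of_le (by norm_num)
  have h1 := (hasTwoJet_line hΩ hyΩ hu2 ((hsym y hyΩ).eigenvectorBasis i)).of_isLocalMax (by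
    filter_upwards [eventually_line_mem hΩ hyΩ ((hsym y hyΩ).eigenvectorBasis i)] with t ht
    simpa using hmax (subset_closure ht))
  rw [dirDeriv_dirDeriv_eq hΩ hyΩ hu2, fderiv_fderiv_eigenvectorBasis_self] at h1
  linarith [h1.2]

lemma continuousOn_gradVec (hΩ : IsOpen Ω) (hu : ContDiffOn ℝ 4 u Ω) :
    ContinuousOn (gradVec u) Ω := by
  have e : gradVec u = fun y => ∑ i, dirDeriv (EuclideanSpace.basisFun (Fin n) ℝ i) u y •
      EuclideanSpace.basisFun (Fin n) ℝ i := funext fun y => gradVec_eq_sum _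
  rw [e]
  refine continuousOn_finsetSum _ fun i _ => ?_
  have h := (hu.dirDeriv (k := 3) hΩ (by norm_num)
    (EuclideanSpace.basisFun (Fin n) ℝ i)).continuousOn
  exact h.smul continuousOn_const

/-- The auxiliary function `(-u)^β D²u(ξ,ξ) |ξ|⁻² exp (a |Du|² / 2)` attains its maximum over
`{u < 0}`, in an eigendirection of the largest eigenvalue of `D²u`. -/
lemma exists_maximum_point (hn : 2 ≤ n) {a β : ℝ} (hβ : 0 < β) (hΩ : IsOpen Ω)
    (hu : ContDiffOn ℝ 4 u Ω) (hsym : ∀ x ∈ Ω, (hessianMat u x).IsHermitian)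
    (hcone : ∀ x (hx : x ∈ Ω), (hsym x hx).eigenvalues ∈ GammaTilde n n α)
    {S : Set (EuclideanSpace ℝ (Fin n))} (hS : IsCompact S) (hSΩ : S ⊆ Ω)
    (hmem : ∀ y ∈ Ω, u y ≤ 0 → y ∈ S) (hx : x ∈ Ω) (hux : u x < 0) :
    ∃ z, ∃ hz : z ∈ Ω, u z < 0 ∧ ∃ o, 0 < (hsym z hz).eigenvalues o ∧
      ∀ y ∈ Ω, u y < 0 → ∀ ξ, (-u y) ^ β * fderiv ℝ (fderiv ℝ u) y ξ ξ *
        Real.exp (a / 2 * ‖gradVec u y‖ ^ 2) ≤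
      (-u z) ^ β * (hsym z hz).eigenvalues o * Real.exp (a / 2 * ‖gradVec u z‖ ^ 2) * ‖ξ‖ ^ 2 := by
  let P : EuclideanSpace ℝ (Fin n) × EuclideanSpace ℝ (Fin n) → ℝ := fun p =>
    (-u p.1) ^ β * fderiv ℝ (fderiv ℝ u) p.1 p.2 p.2 * Real.exp (a / 2 * ‖gradVec u p.1‖ ^ 2)
  have hcu : ContinuousOn u Ω := hu.continuousOn
  let T := S ∩ u ⁻¹' Set.Iic 0
  have hT : IsCompact T := hS.of_isClosed_subset
    ((hcu.mono hSΩ).preimage_isClosed_of_isClosed hS.isClosed isClosed_Iic) Set.inter_subset_left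
  have hTΩ : T ⊆ Ω := Set.inter_subset_left.trans hSΩ
  have hc2 : ContinuousOn (fderiv ℝ (fderiv ℝ u)) Ω :=
    ((hu.fderiv_of_isOpen (m := 3) hΩ (by norm_num)).fderiv_of_isOpen (m := 2) hΩ
      (by norm_num)).continuousOn
  have hfst : Set.MapsTo Prod.fst (T ×ˢ Metric.sphere (0 : EuclideanSpace ℝ (Fin n)) 1) Ω :=
    fun p hp => hTΩ hp.1
  have hP : ContinuousOn P (T ×ˢ Metric.sphere (0 : EuclideanSpace ℝ (Fin n)) 1) := by
    have k1 := hcu.comp continuous_fst.continuousOn hfst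
    have k2 := hc2.comp continuous_fst.continuousOn hfst
    have k3 := (continuousOn_gradVec hΩ hu).comp continuous_fst.continuousOn hfst
    refine ((k1.neg.rpow_const fun _ _ => Or.inr hβ.le).mul
      ((k2.clm_apply continuous_snd.continuousOn).clm_apply continuous_snd.continuousOn)).mul ?_
    exact (Real.continuous_exp.comp_continuousOn (continuousOn_const.mul (k3.norm.pow 2)))
  obtain ⟨i, hi⟩ := exists_pos_of_mem_GammaTilde hn (hcone x hx)
  have hin : (x, (hsym x hx).eigenvectorBasis i) ∈
      T ×ˢ Metric.sphere (0 : EuclideanSpace ℝ (Fin n)) 1 :=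
    ⟨⟨hmem x hx hux.le, hux.le⟩, by simp⟩
  obtain ⟨⟨z, ξ₀⟩, ⟨hzT, hξ₀⟩, hmax⟩ := (hT.prod (isCompact_sphere _ _)).exists_isMaxOn ⟨_, hin⟩ hP
  have hz : z ∈ Ω := hTΩ hzT
  have hPz : 0 < P (z, ξ₀) := by
    refine lt_of_lt_of_le ?_ (hmax hin)
    simp only [P, fderiv_fderiv_eigenvectorBasis_self]
    have := Real.rpow_pos_of_pos (neg_pos.2 hux) β
    positivity
  have huz : u z < 0 := by
    refine lt_of_le_of_ne hzT.2 fun h0 => ?_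
    simp [P, h0, Real.zero_rpow hβ.ne'] at hPz
  have : Nonempty (Fin n) := ⟨i⟩
  obtain ⟨o, -, ho⟩ := Finset.exists_max_image univ (hsym z hz).eigenvalues univ_nonempty
  obtain ⟨j, hj⟩ := exists_pos_of_mem_GammaTilde hn (hcone z hz)
  refine ⟨z, hz, huz, o, hj.trans_le (ho j (mem_univ j)), fun y hy huy ξ => ?_⟩
  have hPle : P (z, ξ₀) ≤ (-u z) ^ β * (hsym z hz).eigenvalues o *
      Real.exp (a / 2 * ‖gradVec u z‖ ^ 2) := by
    have h1 := fderiv_fderiv_self_le (hsym z hz) (fun i => ho i (mem_univ i)) ξ₀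
    rw [mem_sphere_zero_iff_norm.1 hξ₀, one_pow, mul_one] at h1
    have := Real.rpow_pos_of_pos (neg_pos.2 huz) β
    exact mul_le_mul_of_nonneg_right (mul_le_mul_of_nonneg_left h1 this.le) (Real.exp_pos _).le
  rcases eq_or_ne ξ 0 with rfl | hξ
  · simp
  have hξn : ‖ξ‖ ≠ 0 := norm_ne_zero_iff.2 hξ
  have hin' : (y, ‖ξ‖⁻¹ • ξ) ∈ T ×ˢ Metric.sphere (0 : EuclideanSpace ℝ (Fin n)) 1 :=
    ⟨⟨hmem y hy huy.le, huy.le⟩, by simp [norm_smul, hξn]⟩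
  have h2 := mul_le_mul_of_nonneg_right ((hmax hin').trans hPle) (sq_nonneg ‖ξ‖)
  refine le_of_eq_of_le ?_ h2
  simp only [P, map_smul, _root_.smul_apply, smul_eq_mul]
  field_simp

end Global

section Estimate

variable {n : ℕ} {α : ℝ} {Ω : Set (EuclideanSpace ℝ (Fin n))} {u : EuclideanSpace ℝ (Fin n) → ℝ}
  {x : EuclideanSpace ℝ (Fin n)}

/-- The Pogorelov estimate on `{u < 0}` when this set is compactly contained in the domain. -/
lemma pogorelov_estimate_of_compact_sublevel (hn : 2 ≤ n) {m M F a β K B C₁ Λ L : ℝ} (hα : 0 < α)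
    (hm : 0 < m) (hM : 0 < M) (hF : 0 < F) (ha : 0 < a) (hβ : 4 ≤ β) (hβa : 4 * a * M ^ 2 ≤ β)
    (hK : 2 * (1 + 2 * n) ≤ K * m) (hK0 : 0 < K) (hC₁ : C₁ = F * (1 + M) ^ 2 + F)
    (hB : B = 4 * C₁ + K * F ^ 2 * (2 + M) ^ 2) (haB : a * m = 32 * B)
    (hΛ : Λ = 1 + 4 / α + 16 * (n * M * F * (1 + M)) / m)
    (hL : L = M * Λ + (1 + 4 * β * M ^ 2 / a) + β * (n * F * (1 + M)) / B)
    (hΩ : IsOpen Ω) (hu : ContDiffOn ℝ 4 u Ω)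
    {G : EuclideanSpace ℝ (Fin n) × ℝ × EuclideanSpace ℝ (Fin n) → ℝ} (hG : ContDiff ℝ 2 G)
    (hGm : ∀ x ∈ Ω, m ≤ G (x, u x, gradVec u x))
    (hGF : ∀ x ∈ Ω, ∀ j : ℕ, j ≤ 2 → ‖iteratedFDeriv ℝ j G (x, u x, gradVec u x)‖ ≤ F)
    (hsym : ∀ x ∈ Ω, (hessianMat u x).IsHermitian)
    (hcone : ∀ x (hx : x ∈ Ω), (hsym x hx).eigenvalues ∈ GammaTilde n n α)
    (heq : ∀ x (hx : x ∈ Ω),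
      Ssum α univ (n : ℤ) ((hsym x hx).eigenvalues) = G (x, u x, gradVec u x))
    (hneg : ∀ x ∈ Ω, -u x ≤ M) (hgrad : ∀ x ∈ Ω, ‖gradVec u x‖ ≤ M)
    {S : Set (EuclideanSpace ℝ (Fin n))} (hS : IsCompact S) (hSΩ : S ⊆ Ω)
    (hmem : ∀ y ∈ Ω, u y ≤ 0 → y ∈ S) (hx : x ∈ Ω) (hux : u x < 0) :
    (-u x) ^ β * (∑ i, hessianMat u x i i) ≤
      n * (M ^ (β - 1) * L * Real.exp (a / 2 * M ^ 2)) := by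
  obtain ⟨z, hz, huz, o, ho, hmax⟩ :=
    exists_maximum_point (a := a) (β := β) hn (by linarith) hΩ hu hsym hcone hS hSΩ hmem hx hux
  set g := (hsym z hz).eigenvalues o with hgdef
  have hB0 : 0 < B := by
    rw [hB, hC₁]; positivity
  have hβ0 : 0 < β := by linarith
  have hv : 0 < -u z := by linarith
  have hΛ0 : 0 < Λ := by rw [hΛ]; positivity
  have hgv : g * -u z ≤ L := by
    have e1 : 0 ≤ M * Λ := by positivity
    have e2 : 0 ≤ 4 * β * M ^ 2 / a := by positivity
    have e3 : 0 ≤ β * (n * F * (1 + M)) / B := by positivity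
    rcases lt_or_ge g Λ with hlt | hge
    · have : g * -u z ≤ Λ * M := mul_le_mul hlt.le (hneg z hz) hv.le hΛ0.le
      rw [hL]; linarith
    rcases lt_or_ge (a * (g * -u z) ^ 2) (4 * β * M ^ 2) with hlt | hbig
    · have : (g * -u z) ^ 2 ≤ 4 * β * M ^ 2 / a := by
        rw [le_div_iff₀ ha]; linarith
      rw [hL]; nlinarith [sq_nonneg (g * -u z - 1), sq_nonneg (g * -u z)]
    have d1 : 0 < 4 / α := by positivity
    have d2 : 0 ≤ 16 * (n * M * F * (1 + M)) / m := by positivity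
    have h1 : 1 ≤ g := by linarith
    have h2 : 4 ≤ α * g := by
      have : 4 / α ≤ g := by linarith
      rw [div_le_iff₀ hα] at this; linarith
    have h3 : 16 * (n * M * F * (1 + M)) ≤ m * g := by
      have : 16 * (n * M * F * (1 + M)) / m ≤ g := by linarith
      rw [div_le_iff₀ hm] at this; linarith
    have hev : ∀ᶠ y in 𝓝 z, y ∈ Ω ∧ u y < 0 :=
      (hΩ.eventually_mem hz).and
        ((hu.continuousOn.continuousAt (hΩ.mem_nhds hz)).eventually_lt continuousAt_const huz)
    have h4 := maximum_point_estimate hn hα hm hM hF ha hβ hβa hK hK0 hC₁ hB haB hΩ hz hu hG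
      (hGm z hz) (hGF z hz) hsym (hcone z hz) heq huz (hgrad z hz) o
      (hev.mono fun y hy => hmax y hy.1 hy.2) h1 h2 h3 hbig
    have h5 : g * -u z ≤ β * (n * F * (1 + M)) / B := by
      rw [le_div_iff₀ hB0]; linarith
    rw [hL]; linarith
  have hL0 : 0 ≤ L := (by positivity : 0 ≤ g * -u z).trans hgv
  have hpow : (-u z) ^ β * g ≤ M ^ (β - 1) * L := by
    have e : (-u z) ^ β = (-u z) ^ (β - 1) * -u z := by
      rw [← Real.rpow_add_one hv.ne']; ring_nf
    rw [e, mul_assoc, mul_comm (-u z) g]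
    exact mul_le_mul (Real.rpow_le_rpow hv.le (hneg z hz) (by linarith)) hgv (by positivity)
      (by positivity)
  have hbound : ∀ y ∈ Ω, Real.exp (a / 2 * ‖gradVec u y‖ ^ 2) ≤ Real.exp (a / 2 * M ^ 2) :=
    fun y hy => by
      have := hgrad y hy
      gcongr
  have heig : ∀ i, (-u x) ^ β * (hsym x hx).eigenvalues i ≤
      M ^ (β - 1) * L * Real.exp (a / 2 * M ^ 2) := fun i => by
    have hxβ : 0 < (-u x) ^ β := Real.rpow_pos_of_pos (neg_pos.2 hux) β
    rcases le_or_gt ((hsym x hx).eigenvalues i) 0 with hi | hi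
    · exact (mul_nonpos_of_nonneg_of_nonpos hxβ.le hi).trans (by positivity)
    have h1 := hmax x hx hux ((hsym x hx).eigenvectorBasis i)
    rw [fderiv_fderiv_eigenvectorBasis_self, (hsym x hx).eigenvectorBasis.orthonormal.1, one_pow,
      mul_one] at h1
    calc (-u x) ^ β * (hsym x hx).eigenvalues i
        ≤ (-u x) ^ β * (hsym x hx).eigenvalues i * Real.exp (a / 2 * ‖gradVec u x‖ ^ 2) :=
          le_mul_of_one_le_right (by positivity) (Real.one_le_exp (by positivity))
      _ ≤ _ := h1
      _ ≤ _ := mul_le_mul hpow (hbound z hz) (Real.exp_pos _).le (by positivity)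
  rw [sum_hessianMat_diag (hsym x hx), Finset.mul_sum]
  refine (Finset.sum_le_sum fun i _ => heig i).trans (le_of_eq ?_)
  simp

lemma hessianMat_add_const (u : EuclideanSpace ℝ (Fin n) → ℝ) (ε : ℝ) :
    hessianMat (fun y => u y + ε) = hessianMat u := by
  ext x i j
  simp only [hessianMat, Matrix.of_apply, iteratedFDeriv_two_apply]
  have : fderiv ℝ (fun y => u y + ε) = fderiv ℝ u := funext fun y => fderiv_add_const ε
  rw [this]

lemma gradVec_add_const (u : EuclideanSpace ℝ (Fin n) → ℝ) (ε : ℝ) :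
    gradVec (fun y => u y + ε) = gradVec u := by
  ext x i
  simp only [gradVec, fderiv_add_const]

lemma eigenvalues_congr {A A' : Matrix (Fin n) (Fin n) ℝ} (h : A = A') (hA : A.IsHermitian)
    (hA' : A'.IsHermitian) : hA.eigenvalues = hA'.eigenvalues := by
  subst h; rfl

end Estimate

/-- Theorem 1.2: Pogorelov type `C²` estimate `(-u)^β Δu ≤ C` for admissible
(`(n-1)`-convex) solutions of `σ_{n-1}(D²u) + α σ_n(D²u) = f(x,u,Du)` in `Ω`,
`u = 0` on `∂Ω`; no lower bound on `σ_n(D²u)` is assumed. -/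
theorem pogorelov_estimate_sum_hessian_top (n : ℕ) (hn : 2 ≤ n)
    (α m M F D : ℝ) (hα : 0 < α) (hm : 0 < m) (hM : 0 < M) (hF : 0 < F) (hD : 0 < D) :
    ∃ β : ℝ, 0 < β ∧ ∃ C : ℝ, 0 < C ∧
      ∀ (Ω : Set (EuclideanSpace ℝ (Fin n)))
        (f : EuclideanSpace ℝ (Fin n) → ℝ → EuclideanSpace ℝ (Fin n) → ℝ)
        (u : EuclideanSpace ℝ (Fin n) → ℝ),
        IsOpen Ω → IsConnected Ω → Bornology.IsBounded Ω → Metric.diam Ω ≤ D →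
        ContDiff ℝ 2 (fun p : EuclideanSpace ℝ (Fin n) × ℝ × EuclideanSpace ℝ (Fin n) =>
          f p.1 p.2.1 p.2.2) →
        (∀ x ∈ closure Ω, ∀ (s : ℝ) (v : EuclideanSpace ℝ (Fin n)), m ≤ f x s v) →
        (∀ p : EuclideanSpace ℝ (Fin n) × ℝ × EuclideanSpace ℝ (Fin n),
          p.1 ∈ closure Ω → ∀ j : ℕ, j ≤ 2 →
            ‖iteratedFDeriv ℝ j
              (fun q : EuclideanSpace ℝ (Fin n) × ℝ × EuclideanSpace ℝ (Fin n) =>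
                f q.1 q.2.1 q.2.2) p‖ ≤ F) →
        ContDiffOn ℝ 4 u Ω → ContDiffOn ℝ 2 u (closure Ω) →
        (∀ x ∈ frontier Ω, u x = 0) →
        ∀ hsym : ∀ x ∈ Ω, (hessianMat u x).IsHermitian,
        (∀ x (hx : x ∈ Ω), (hsym x hx).eigenvalues ∈ GammaTilde n n α) →
        (∀ x (hx : x ∈ Ω),
          Ssum α Finset.univ (n : ℤ) ((hsym x hx).eigenvalues) = f x (u x) (gradVec u x)) →
        (∀ x ∈ closure Ω, |u x| ≤ M ∧ ‖gradVec u x‖ ≤ M) →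
        ∀ x ∈ Ω, (-u x) ^ β * (∑ i : Fin n, hessianMat u x i i) ≤ C := by
  have hn0 : (0 : ℝ) < n := by exact_mod_cast (by omega : 0 < n)
  obtain ⟨K, hK⟩ : ∃ K : ℝ, K = 2 * (1 + 2 * n) / m := ⟨_, rfl⟩
  obtain ⟨C₁, hC₁⟩ : ∃ C₁ : ℝ, C₁ = F * (1 + M) ^ 2 + F := ⟨_, rfl⟩
  obtain ⟨B, hB⟩ : ∃ B : ℝ, B = 4 * C₁ + K * F ^ 2 * (2 + M) ^ 2 := ⟨_, rfl⟩
  obtain ⟨a, ha⟩ : ∃ a : ℝ, a = 32 * B / m := ⟨_, rfl⟩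
  obtain ⟨β, hβ⟩ : ∃ β : ℝ, β = 4 + 4 * a * M ^ 2 := ⟨_, rfl⟩
  obtain ⟨Λ, hΛ⟩ : ∃ Λ : ℝ, Λ = 1 + 4 / α + 16 * (n * M * F * (1 + M)) / m := ⟨_, rfl⟩
  obtain ⟨L, hL⟩ : ∃ L : ℝ,
    L = M * Λ + (1 + 4 * β * M ^ 2 / a) + β * (n * F * (1 + M)) / B := ⟨_, rfl⟩
  have hK0 : 0 < K := by rw [hK]; positivity
  have hC₁0 : 0 < C₁ := by rw [hC₁]; positivity
  have hB0 : 0 < B := by rw [hB]; positivity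
  have ha0 : 0 < a := by rw [ha]; positivity
  have hβ0 : 0 < β := by rw [hβ]; positivity
  have hΛ0 : 0 < Λ := by rw [hΛ]; positivity
  have hL0 : 0 < L := by rw [hL]; positivity
  have hC : 0 < n * (M ^ (β - 1) * L * Real.exp (a / 2 * M ^ 2)) := by positivity
  refine ⟨β, hβ0, _, hC, ?_⟩
  intro Ω f u hΩ _ hb _ hf hfm hfF hu hu2 hfr hsym hcone heq hbd x hx
  obtain ⟨G, hG⟩ : ∃ G : EuclideanSpace ℝ (Fin n) × ℝ × EuclideanSpace ℝ (Fin n) → ℝ,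
    G = fun p => f p.1 p.2.1 p.2.2 := ⟨_, rfl⟩
  rw [← hG] at hf hfF
  have hcont : ContinuousOn u (closure Ω) := hu2.continuousOn
  have hle : ∀ y ∈ Ω, u y ≤ 0 := fun y hy =>
    nonpos_of_frontier hn hΩ hb hu hcont hfr hsym hcone hy
  rcases (hle x hx).eq_or_lt with h0 | hneg
  · rw [h0, neg_zero, Real.zero_rpow hβ0.ne', zero_mul]
    exact hC.le
  have hshift : ∀ ε : ℝ, 0 < ε → ε < -u x → (-(u x + ε)) ^ β * (∑ i, hessianMat u x i i) ≤
      n * (M ^ (β - 1) * L * Real.exp (a / 2 * M ^ 2)) := by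
    intro ε hε hεx
    have hH := hessianMat_add_const u ε
    have hg := gradVec_add_const u ε
    have hsym' : ∀ y ∈ Ω, (hessianMat (fun y => u y + ε) y).IsHermitian := fun y hy => by
      rw [hH]; exact hsym y hy
    have heig : ∀ y (hy : y ∈ Ω), (hsym' y hy).eigenvalues = (hsym y hy).eigenvalues :=
      fun y hy => eigenvalues_congr (congrFun hH y) _ _
    have hS : IsCompact (closure Ω ∩ u ⁻¹' Set.Iic (-ε)) :=
      hb.isCompact_closure.of_isClosed_subset
        (hcont.preimage_isClosed_of_isClosed isClosed_closure isClosed_Iic) Set.inter_subset_left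
    have hSΩ : closure Ω ∩ u ⁻¹' Set.Iic (-ε) ⊆ Ω := by
      rintro y ⟨hy, hyε : u y ≤ -ε⟩
      by_contra hyn
      have := hfr y ⟨hy, by rwa [hΩ.interior_eq]⟩
      linarith
    have key := pogorelov_estimate_of_compact_sublevel (u := fun y => u y + ε) (x := x)
      (G := fun p => G (p + (0, -ε, 0)))
      hn hα hm hM hF ha0 (by rw [hβ]; linarith [mul_pos (mul_pos four_pos ha0) (pow_pos hM 2)])
      (by rw [hβ]; linarith) (by rw [hK, div_mul_cancel₀ _ hm.ne']) hK0 hC₁ hB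
      (by rw [ha, div_mul_cancel₀ _ hm.ne']) hΛ hL hΩ (hu.add contDiffOn_const)
      (hf.comp (contDiff_id.add contDiff_const))
      (fun y hy => by simpa [hG, hg] using hfm y (subset_closure hy) _ _)
      (fun y hy j hj => by
        rw [iteratedFDeriv_comp_add_right]
        exact hfF _ (by rw [Prod.fst_add, add_zero]; exact subset_closure hy) j hj)
      hsym' (fun y hy => by rw [heig y hy]; exact hcone y hy)
      (fun y hy => by simpa [hG, heig y hy, hg] using heq y hy)
      (fun y hy => by linarith [neg_abs_le (u y), (hbd y (subset_closure hy)).1])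
      (fun y hy => by rw [hg]; exact (hbd y (subset_closure hy)).2)
      hS hSΩ (fun y hy hy0 => ⟨subset_closure hy, by
        change u y ≤ -ε
        linarith⟩) hx (by linarith)
    rwa [hH] at key
  have hlim : Filter.Tendsto (fun ε : ℝ => (-(u x + ε)) ^ β * (∑ i, hessianMat u x i i))
      (𝓝[>] 0) (𝓝 ((-u x) ^ β * (∑ i, hessianMat u x i i))) := by
    have hc : Continuous fun ε : ℝ => (-(u x + ε)) ^ β * (∑ i, hessianMat u x i i) :=
      ((by fun_prop : Continuous fun ε : ℝ => -(u x + ε)).rpow_const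
        fun _ => Or.inr hβ0.le).mul continuous_const
    simpa using (hc.tendsto 0).mono_left nhdsWithin_le_nhds
  refine le_of_tendsto hlim ?_
  filter_upwards [Ioo_mem_nhdsGT (neg_pos.2 hneg)] with ε hε
  exact hshift ε hε.1 hε.2
end

section
/- For every pair of integers 1 ≤ k ≤ n there exists a constant C(n,k) > 0, depending only on n and k, such that for every λ = (λ_1,…,λ_n) ∈ Γ_k with λ_1 ≥ λ_2 ≥ ⋯ ≥ λ_n, one has σ_k(λ) ≤ C(n,k)·λ_1·λ_2⋯λ_k. -/
open Finset

open Polynomial in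
/-- The polynomial `∏ i, (1 + λ_i X)`, whose coefficients are the `σ_j(λ)`. -/
noncomputable def esymmGen {n : ℕ} (lam : Fin n → ℝ) : ℝ[X] :=
  ∏ i, (1 + C (lam i) * X)

theorem esigma_univ_eq_coeff_s5 {n : ℕ} (lam : Fin n → ℝ) (j : ℕ) :
    esigma Finset.univ (j : ℤ) lam = (esymmGen lam).coeff j := by
  have hterm (t : Finset (Fin n)) :
      (∏ i ∈ t, (Polynomial.C (lam i) * Polynomial.X)).coeff j =
        if t.card = j then ∏ i ∈ t, lam i else 0 := by
    rw [Finset.prod_mul_distrib, Finset.prod_const, ← map_prod, Polynomial.coeff_C_mul_X_pow]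
    simp only [eq_comm]
  rw [esymmGen, Finset.prod_one_add, Polynomial.finsetSum_coeff]
  simp only [hterm, esigma, Int.natCast_nonneg, if_true, Int.toNat_natCast]
  rw [← Finset.sum_filter, Finset.powersetCard_eq_filter]

theorem esymmGen_succ {n : ℕ} (lam : Fin (n + 1) → ℝ) :
    esymmGen lam = (1 + Polynomial.C (lam 0) * Polynomial.X) * esymmGen (Fin.tail lam) := by
  simp [esymmGen, Fin.prod_univ_succ, Fin.tail]

theorem esymmGen_coeff_zero {n : ℕ} (lam : Fin n → ℝ) : (esymmGen lam).coeff 0 = 1 := by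
  simp [esymmGen, Polynomial.coeff_zero_prod]

theorem esymmGen_coeff_succ {n : ℕ} (lam : Fin (n + 1) → ℝ) (j : ℕ) :
    (esymmGen lam).coeff (j + 1) =
      (esymmGen (Fin.tail lam)).coeff (j + 1) + lam 0 * (esymmGen (Fin.tail lam)).coeff j := by
  rw [esymmGen_succ, add_mul, one_mul, mul_assoc, Polynomial.coeff_add, Polynomial.coeff_C_mul,
    Polynomial.coeff_X_mul]

theorem esymmGen_coeff_one {n : ℕ} (lam : Fin n → ℝ) :
    (esymmGen lam).coeff 1 = ∑ i, lam i := by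
  induction n with
  | zero => simp [esymmGen, Polynomial.coeff_one]
  | succ n ih =>
    rw [esymmGen_coeff_succ lam 0, esymmGen_coeff_zero, ih, Fin.sum_univ_succ]
    simp [Fin.tail, add_comm]

theorem esymmGen_splits {n : ℕ} (lam : Fin n → ℝ) : (esymmGen lam).Splits := by
  refine Polynomial.Splits.prod fun i _ => Polynomial.Splits.of_natDegree_le_one ?_
  compute_degree

/-- The derivative of a real-rooted polynomial is real-rooted. -/
theorem Polynomial.Splits.derivative_real {p : Polynomial ℝ} (hp : p.Splits) :
    (Polynomial.derivative p).Splits := by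
  rw [Polynomial.splits_iff_card_roots] at hp ⊢
  have h1 := Polynomial.card_roots_le_derivative p
  have h2 := Polynomial.card_roots' (Polynomial.derivative p)
  have h3 := Polynomial.natDegree_derivative_le p
  omega

/-- The Laguerre inequality `p p'' ≤ p' ^ 2` for real-rooted polynomials. -/
theorem Polynomial.Splits.laguerre {p : Polynomial ℝ} (hp : p.Splits) (x : ℝ) :
    p.eval x * (derivative (derivative p)).eval x ≤ (derivative p).eval x ^ 2 := by
  have key (s : Multiset ℝ) (c : ℝ) : let q := C c * (s.map fun a => X - C a).prod
      q.eval x * (derivative (derivative q)).eval x ≤ (derivative q).eval x ^ 2 := by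
    induction s using Multiset.induction_on with
    | empty => simp
    | cons a s ih =>
      intro q
      obtain ⟨r, hr⟩ : ∃ r, r = C c * (s.map fun a => X - C a).prod := ⟨_, rfl⟩
      have hq : q = (X - C a) * r := by
        simp only [q, hr, Multiset.map_cons, Multiset.prod_cons]; ring
      simp only [← hr] at ih
      simp only [hq, derivative_mul, derivative_sub, derivative_X, derivative_C, derivative_add,
        sub_zero, one_mul, eval_add, eval_mul, eval_sub, eval_X, eval_C]
      nlinarith [mul_le_mul_of_nonneg_left ih (sq_nonneg (x - a)), sq_nonneg (r.eval x)]
  rw [hp.eq_prod_roots]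
  exact key _ _

/-- Newton's inequality for the coefficients of a real-rooted polynomial. -/
theorem Polynomial.Splits.coeff_mul_coeff_le {p : Polynomial ℝ} (hp : p.Splits) (m : ℕ) :
    (m + 2) * (p.coeff m * p.coeff (m + 2)) ≤ (m + 1) * p.coeff (m + 1) ^ 2 := by
  have hq : (derivative^[m] p).Splits := by
    induction m with
    | zero => exact hp
    | succ m ih => rw [Function.iterate_succ_apply']; exact ih.derivative_real
  have h := hq.laguerre 0
  rw [← Function.iterate_succ_apply' derivative, ← Function.iterate_succ_apply' derivative] at h
  simp only [← coeff_zero_eq_eval_zero, coeff_iterate_derivative, zero_add,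
    Nat.descFactorial_self, nsmul_eq_mul, Nat.succ_eq_add_one, Nat.factorial_succ] at h
  push_cast at h
  have hf : (0 : ℝ) < (m.factorial : ℝ) ^ 2 * (m + 1) := by positivity
  refine le_of_mul_le_mul_left ?_ hf
  linarith

theorem esymmGen_tail_coeff_pos {n k : ℕ} {lam : Fin (n + 1) → ℝ}
    (h : ∀ j ≤ k + 1, 0 < (esymmGen lam).coeff j) :
    ∀ j ≤ k, 0 < (esymmGen (Fin.tail lam)).coeff j := by
  intro j
  induction j with
  | zero => simp [esymmGen_coeff_zero]
  | succ m ih =>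
    intro hm
    have h0 := ih (by omega)
    have h1 := h (m + 1) (by omega)
    have h2 := h (m + 2) (by omega)
    rw [esymmGen_coeff_succ] at h1 h2
    have hN := (esymmGen_splits (Fin.tail lam)).coeff_mul_coeff_le m
    set a := (esymmGen (Fin.tail lam)).coeff m
    set b := (esymmGen (Fin.tail lam)).coeff (m + 1)
    set c := (esymmGen (Fin.tail lam)).coeff (m + 2)
    by_contra! hb
    have hac : b ^ 2 < a * c := by
      nlinarith [mul_pos h0 h2, mul_nonneg (neg_nonneg.2 hb) h1.le]
    have hm0 : (0 : ℝ) ≤ m := m.cast_nonneg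
    nlinarith [mul_le_mul_of_nonneg_left hac.le hm0, sq_nonneg b]

theorem pos_of_antitone_of_coeff_one_pos {n : ℕ} {lam : Fin (n + 1) → ℝ} (ha : Antitone lam)
    (h : 0 < (esymmGen lam).coeff 1) : 0 < lam 0 := by
  rw [esymmGen_coeff_one] at h
  obtain ⟨i, -, hi⟩ := Finset.exists_lt_of_sum_lt (f := fun _ => (0 : ℝ)) (by simpa using h)
  exact hi.trans_le (ha (Fin.zero_le i))

theorem Antitone.fin_tail {n : ℕ} {lam : Fin (n + 1) → ℝ} (ha : Antitone lam) :
    Antitone (Fin.tail lam) :=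
  fun _ _ hij => ha (Fin.succ_le_succ_iff.2 hij)

/-- `σ_{k+1}(λ) ≤ n λ_1 σ_k(λ | 1)` for ordered `λ ∈ Γ_{k+1}`. -/
theorem esymmGen_coeff_succ_le {n k : ℕ} {lam : Fin (n + 1) → ℝ} (ha : Antitone lam)
    (h : ∀ j ≤ k + 1, 0 < (esymmGen lam).coeff j) :
    (esymmGen lam).coeff (k + 1) ≤
      (n + 1) * (lam 0 * (esymmGen (Fin.tail lam)).coeff k) := by
  have hpos := pos_of_antitone_of_coeff_one_pos ha (h 1 (by omega))
  have htail := esymmGen_tail_coeff_pos h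
  have hprod := mul_pos hpos (htail k le_rfl)
  induction n with
  | zero =>
    rw [esymmGen_coeff_succ]
    simp [esymmGen, Polynomial.coeff_one]
  | succ n ih =>
    rw [esymmGen_coeff_succ]
    push_cast
    have hn : (0 : ℝ) ≤ n := n.cast_nonneg
    rcases le_or_gt ((esymmGen (Fin.tail lam)).coeff (k + 1)) 0 with hle | hgt
    · nlinarith [mul_nonneg hn hprod.le]
    · have h' : ∀ j ≤ k + 1, 0 < (esymmGen (Fin.tail lam)).coeff j := by
        intro j hj
        rcases Nat.le_succ_iff.1 hj with hj | rfl
        exacts [htail j hj, hgt]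
      have hpos' := pos_of_antitone_of_coeff_one_pos ha.fin_tail (h' 1 (by omega))
      have htail' := esymmGen_tail_coeff_pos h'
      have hB := ih ha.fin_tail h' hpos' htail' (mul_pos hpos' (htail' k le_rfl))
      have hdrop : (esymmGen (Fin.tail (Fin.tail lam))).coeff k ≤
          (esymmGen (Fin.tail lam)).coeff k := by
        cases k with
        | zero => simp [esymmGen_coeff_zero]
        | succ k =>
          rw [esymmGen_coeff_succ (Fin.tail lam)]
          exact le_add_of_nonneg_right (mul_pos hpos' (htail' k (by omega))).le
      have hle : Fin.tail lam 0 ≤ lam 0 := ha (Fin.zero_le _)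
      have hmul := mul_le_mul hle hdrop (htail' k le_rfl).le hpos.le
      have := mul_le_mul_of_nonneg_left hmul (by positivity : (0 : ℝ) ≤ n + 1)
      linarith

theorem esymmGen_coeff_le_prod {n k : ℕ} (hkn : k ≤ n) {lam : Fin n → ℝ} (ha : Antitone lam)
    (h : ∀ j ≤ k, 0 < (esymmGen lam).coeff j) :
    (esymmGen lam).coeff k ≤ (n : ℝ) ^ k * ∏ i : Fin n, if (i : ℕ) < k then lam i else 1 := by
  induction k generalizing n with
  | zero => simp [esymmGen_coeff_zero]
  | succ k ih =>
    obtain ⟨n, rfl⟩ : ∃ m, n = m + 1 := ⟨n - 1, by omega⟩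
    have hpos := pos_of_antitone_of_coeff_one_pos ha (h 1 (by omega))
    have htail := esymmGen_tail_coeff_pos h
    have hI := ih (by omega) ha.fin_tail htail
    simp only [Fin.prod_univ_succ, Fin.val_zero, Fin.val_succ, Nat.succ_pos, if_true,
      Nat.add_lt_add_iff_right]
    change _ ≤ _ * (lam 0 * ∏ i : Fin n, if (i : ℕ) < k then Fin.tail lam i else 1)
    set P := ∏ i : Fin n, if (i : ℕ) < k then Fin.tail lam i else 1
    have hP : 0 < P := pos_of_mul_pos_right ((htail k le_rfl).trans_le hI) (by positivity)
    calc (esymmGen lam).coeff (k + 1)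
        ≤ (n + 1) * (lam 0 * (esymmGen (Fin.tail lam)).coeff k) := esymmGen_coeff_succ_le ha h
      _ ≤ (n + 1) * (lam 0 * ((n + 1) ^ k * P)) := by
        gcongr
        refine hI.trans ?_
        gcongr
        linarith
      _ = ((n + 1 : ℕ) : ℝ) ^ (k + 1) * (lam 0 * P) := by push_cast; ring

/-- Lemma 2.2 (ii): there is `C = C(n,k) > 0` with `σ_k(λ) ≤ C λ_1 ⋯ λ_k`
for all ordered `λ ∈ Γ_k`. -/
theorem esigma_le_prod {n k : ℕ} (hk1 : 1 ≤ k) (hkn : k ≤ n) :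
    ∃ C : ℝ, 0 < C ∧ ∀ lam : Fin n → ℝ, lam ∈ Gamma n k → Antitone lam →
      esigma Finset.univ (k : ℤ) lam
        ≤ C * ∏ i ∈ Finset.univ.filter (fun i : Fin n => (i : ℕ) < k), lam i := by
  have hn : 0 < n := by omega
  refine ⟨(n : ℝ) ^ k, by positivity, fun lam h ha => ?_⟩
  rw [esigma_univ_eq_coeff_s5, Finset.prod_filter]
  refine esymmGen_coeff_le_prod hkn ha fun j hj => ?_
  rcases Nat.eq_zero_or_pos j with rfl | hj0
  · simp [esymmGen_coeff_zero]
  · rw [← esigma_univ_eq_coeff_s5]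
    exact h j hj0 hj
end

section
/- Let 1 ≤ k ≤ n and λ = (λ_1,…,λ_n) ∈ Γ_k with λ_1 ≥ λ_2 ≥ ⋯ ≥ λ_n. Then for every integer l with 1 ≤ l ≤ k−1, one has σ_l(λ) ≥ λ_1·λ_2⋯λ_l. -/
open Finset

open Polynomial in
/-- The derivative of a real polynomial with only real roots has only real roots. -/
theorem Polynomial.Splits.derivative_real_s6 {p : ℝ[X]} (hp : p.Splits) : p.derivative.Splits := by
  rw [splits_iff_card_roots] at hp ⊢
  have h := card_roots_le_derivative p
  have h₁ := natDegree_derivative_le p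
  have h₂ := card_roots' (derivative p)
  by_cases h₀ : p.natDegree = 0
  · rw [derivative_of_natDegree_zero h₀]
    simp
  · omega

open Polynomial in
/-- Laguerre's inequality at the origin for a real polynomial with only real roots. -/
theorem Polynomial.Splits.two_mul_coeff_zero_mul_coeff_two_le {p : ℝ[X]} (hp : p.Splits) :
    2 * (p.coeff 0 * p.coeff 2) ≤ p.coeff 1 ^ 2 := by
  suffices H : ∀ s : Multiset ℝ,
      2 * ((s.map (X - C ·)).prod.coeff 0 * (s.map (X - C ·)).prod.coeff 2)
        ≤ (s.map (X - C ·)).prod.coeff 1 ^ 2 by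
    rw [hp.eq_prod_roots]
    simp only [coeff_C_mul]
    nlinarith [mul_le_mul_of_nonneg_left (H p.roots) (sq_nonneg p.leadingCoeff)]
  intro s
  induction s using Multiset.induction_on with
  | empty => simp [coeff_one]
  | cons r s ih =>
    simp only [Multiset.map_cons, Multiset.prod_cons]
    generalize (s.map (X - C ·)).prod = q at ih ⊢
    simp only [sub_mul, coeff_sub, coeff_C_mul, coeff_X_mul_zero, coeff_X_mul]
    nlinarith [mul_le_mul_of_nonneg_left ih (sq_nonneg r), sq_nonneg (q.coeff 0)]

open Polynomial in
/-- The coefficients of a real polynomial with only real roots are log-concave. -/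
theorem Polynomial.Splits.coeff_mul_coeff_le_sq {p : ℝ[X]} (hp : p.Splits) (m : ℕ) :
    p.coeff m * p.coeff (m + 2) ≤ p.coeff (m + 1) ^ 2 := by
  have hsplit : (derivative^[m] p).Splits := by
    induction m with
    | zero => exact hp
    | succ m ih =>
      rw [Function.iterate_succ_apply']
      exact ih.derivative_real_s6
  have h := hsplit.two_mul_coeff_zero_mul_coeff_two_le
  simp only [coeff_iterate_derivative, nsmul_eq_mul, zero_add] at h
  rw [add_comm 1 m, add_comm 2 m, Nat.descFactorial_self] at h
  have h₁ : (m + 1).descFactorial m = (m + 1) * m.factorial := by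
    have := Nat.factorial_mul_descFactorial (show m ≤ m + 1 by omega)
    simpa [Nat.factorial_succ] using this
  have h₂ : 2 * (m + 2).descFactorial m = (m + 2) * (m + 1) * m.factorial := by
    have := Nat.factorial_mul_descFactorial (show m ≤ m + 2 by omega)
    simpa [Nat.factorial_succ, mul_assoc] using this
  have h₂' : (2 : ℝ) * (m + 2).descFactorial m = (m + 2) * (m + 1) * m.factorial := by
    exact_mod_cast h₂
  rw [h₁] at h
  push_cast at h
  have hf : (0 : ℝ) < m.factorial := by exact_mod_cast m.factorial_pos
  have hm : (0 : ℝ) ≤ m := m.cast_nonneg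
  generalize p.coeff m = a at *
  generalize p.coeff (m + 1) = b at *
  generalize p.coeff (m + 2) = c at *
  have key : (m + 2) * (a * c) ≤ (m + 1) * b ^ 2 := by
    have hpos : (0 : ℝ) < m.factorial ^ 2 * (m + 1) := by positivity
    refine le_of_mul_le_mul_left ?_ hpos
    calc (m.factorial ^ 2 * (m + 1) : ℝ) * ((m + 2) * (a * c))
        = m.factorial * (a * c) * ((m + 2) * (m + 1) * m.factorial) := by ring
      _ = 2 * (m.factorial * a * ((m + 2).descFactorial m * c)) := by rw [← h₂']; ring
      _ ≤ ((m + 1) * m.factorial * b) ^ 2 := h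
      _ = _ := by ring
  by_contra! hlt
  nlinarith [sq_nonneg b, mul_lt_mul_of_pos_left hlt (show (0 : ℝ) < m + 1 by positivity)]

namespace Multiset

theorem esymm_zero_right {R : Type*} [CommSemiring R] (s : Multiset R) : s.esymm 0 = 1 := by
  simp [esymm]

theorem esymm_cons_succ {R : Type*} [CommSemiring R] (a : R) (s : Multiset R) (j : ℕ) :
    (a ::ₘ s).esymm (j + 1) = s.esymm (j + 1) + a * s.esymm j := by
  simp [esymm, powersetCard_cons, sum_map_mul_left]

theorem esymm_one_right {R : Type*} [CommSemiring R] (s : Multiset R) : s.esymm 1 = s.sum := by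
  simp [esymm, powersetCard_one]

theorem esymm_eq_zero_of_card_lt {R : Type*} [CommSemiring R] {s : Multiset R} {j : ℕ}
    (h : card s < j) : s.esymm j = 0 := by
  simp [esymm, powersetCard_eq_empty j h]

open Polynomial in
/-- Newton's inequality, in its weak form, for real numbers of arbitrary sign. -/
theorem esymm_mul_esymm_le_sq (s : Multiset ℝ) (j : ℕ) :
    s.esymm j * s.esymm (j + 2) ≤ s.esymm (j + 1) ^ 2 := by
  rcases lt_or_ge (card s) (j + 2) with h | h
  · rw [esymm_eq_zero_of_card_lt h, mul_zero]
    exact sq_nonneg _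
  · obtain ⟨m, hm⟩ := Nat.exists_eq_add_of_le h
    have hsplit : (s.map fun r => X + C r).prod.Splits :=
      Splits.multisetProd fun f hf => by
        obtain ⟨r, -, rfl⟩ := mem_map.1 hf
        exact Splits.X_add_C r
    have key := hsplit.coeff_mul_coeff_le_sq m
    rw [prod_X_add_C_coeff s (by omega), prod_X_add_C_coeff s (by omega),
      prod_X_add_C_coeff s (by omega), show card s - m = j + 2 by omega,
      show card s - (m + 1) = j + 1 by omega, show card s - (m + 2) = j by omega] at key
    linarith

/-- Removing an entry maps the Gårding cone `Γ_{k+1}` into `Γ_k`. -/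
theorem esymm_pos_of_cons {a : ℝ} {s : Multiset ℝ} {k : ℕ}
    (h : ∀ j ≤ k + 1, 0 < (a ::ₘ s).esymm j) : ∀ j ≤ k, 0 < s.esymm j := by
  intro j
  induction j with
  | zero => simp [esymm_zero_right]
  | succ j ih =>
    intro hj
    have h₀ := ih (by omega)
    have h₁ := h (j + 1) (by omega)
    have h₂ := h (j + 2) (by omega)
    rw [esymm_cons_succ] at h₁ h₂
    have hN := s.esymm_mul_esymm_le_sq j
    by_contra! hle
    have ha : 0 < a := pos_of_mul_pos_left (by linarith) h₀.le
    nlinarith [mul_pos h₀ h₂, mul_nonneg (neg_nonneg.2 hle) h₁.le]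

end Multiset

theorem esigma_natCast {n : ℕ} (A : Finset (Fin n)) (j : ℕ) (lam : Fin n → ℝ) :
    esigma A (j : ℤ) lam = (A.val.map lam).esymm j := by
  simp [esigma, Finset.esymm_map_val]

/-- The product of the `l` largest entries is at most the `l`-th elementary symmetric function on
tails `{i | m ≤ i}` in the Gårding cone `Γ_{l+1}`. -/
theorem prod_le_esymm_tail {n : ℕ} {lam : Fin n → ℝ} (hord : Antitone lam) (l m : ℕ)
    (h : ∀ j ≤ l + 1, 0 < ((univ.filter fun i : Fin n => m ≤ i).val.map lam).esymm j) :
    ∏ i ∈ univ.filter (fun i : Fin n => m ≤ i ∧ (i : ℕ) < m + l), lam i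
      ≤ ((univ.filter fun i : Fin n => m ≤ i).val.map lam).esymm l := by
  induction l generalizing m with
  | zero =>
    rw [Multiset.esymm_zero_right, filter_false_of_mem (by intros; omega), prod_empty]
  | succ l ih =>
    have hsum : 0 < ∑ i ∈ univ.filter (fun i : Fin n => m ≤ i), lam i := by
      have := h 1 (by omega)
      rwa [Multiset.esymm_one_right] at this
    obtain ⟨i₀, hi₀, hpos⟩ := exists_lt_of_sum_lt (f := fun _ => (0 : ℝ)) (by simpa using hsum)
    have hmi : m ≤ i₀ := (mem_filter.1 hi₀).2
    have hmn : m < n := hmi.trans_lt i₀.isLt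
    have ha : 0 < lam ⟨m, hmn⟩ := hpos.trans_le (hord (Fin.le_def.2 hmi))
    have hA : (univ.filter fun i : Fin n => m ≤ i)
        = cons ⟨m, hmn⟩ (univ.filter fun i : Fin n => m + 1 ≤ i) (by simp) := by
      ext i
      simp only [mem_filter_univ, mem_cons, Fin.ext_iff]
      omega
    have hB : (univ.filter fun i : Fin n => m ≤ i ∧ (i : ℕ) < m + (l + 1))
        = cons ⟨m, hmn⟩ (univ.filter fun i : Fin n => m + 1 ≤ i ∧ (i : ℕ) < m + 1 + l)
          (by simp) := by
      ext i
      simp only [mem_filter_univ, mem_cons, Fin.ext_iff]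
      omega
    rw [hA, cons_val, Multiset.map_cons] at h ⊢
    rw [hB, prod_cons, Multiset.esymm_cons_succ]
    have htail := Multiset.esymm_pos_of_cons h
    have hle := mul_le_mul_of_nonneg_left (ih (m + 1) htail) ha.le
    linarith [htail (l + 1) le_rfl]

/-- Lemma 2.2 (iii): for ordered `λ ∈ Γ_k` and `1 ≤ l ≤ k-1`,
`σ_l(λ) ≥ λ_1 ⋯ λ_l`. -/
theorem esigma_ge_prod {n k : ℕ} (hk1 : 1 ≤ k) (hkn : k ≤ n)
    (lam : Fin n → ℝ) (hlam : lam ∈ Gamma n k) (hord : Antitone lam)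
    (l : ℕ) (hl1 : 1 ≤ l) (hlk : l ≤ k - 1) :
    esigma Finset.univ (l : ℤ) lam
      ≥ ∏ i ∈ Finset.univ.filter (fun i : Fin n => (i : ℕ) < l), lam i := by
  have h : ∀ j ≤ l + 1, 0 < ((univ.filter fun i : Fin n => 0 ≤ (i : ℕ)).val.map lam).esymm j := by
    intro j hj
    rcases Nat.eq_zero_or_pos j with rfl | hj0
    · simp [Multiset.esymm_zero_right]
    · have := hlam j hj0 (by omega)
      rw [esigma_natCast] at this
      simpa using this
  rw [esigma_natCast]
  simpa using prod_le_esymm_tail hord l 0 h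
end
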